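/- For Re(k_1), Re(k_2) ≥ 0 and n ≥ 1, (2π)^{-n/2} ∫_{ℝ^n} ∏_{j=1}^n |x_j|^{2k_1} ∏_{1≤j<k≤n}|x_j²−x_k²|^{2k_2} e^{-|x|²/2} dx = 2^{-n k_1} ∏_{j=1}^n [Γ(1+2k_1+2k_2(j−1))/Γ(1+k_1+k_2(j−1))] · [Γ(1+j k_2)/Γ(1+k_2)]. -/

import Mathlib

open MeasureTheory Complex Finset

namespace MacdonaldMehta

/-- The Vandermonde product of differences. -/
def vdm {n : ℕ} (x : Fin n → ℝ) : ℝ := ∏ i, ∏ j ∈ Ioi i, (x j - x i)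

lemma prod_prod_erase_eq_sq {n : ℕ} {M : Type*} [CommMonoid M] (f : Fin n → Fin n → M)
    (hf : ∀ i j, f i j = f j i) :
    ∏ j, ∏ k ∈ univ.erase j, f j k = (∏ i, ∏ j ∈ Ioi i, f i j) ^ 2 := by
  have h : ∀ j : Fin n, ∏ k ∈ univ.erase j, f j k =
      (∏ k ∈ Iio j, f j k) * ∏ k ∈ Ioi j, f j k := by
    intro j
    rw [← prod_union]
    · congr 1
      ext k
      simp [lt_or_lt_iff_ne]
    · rw [Finset.disjoint_left]
      intro k hk hk'
      simp at hk hk'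
      exact absurd hk hk'.asymm
  simp_rw [h, prod_mul_distrib, sq]
  congr 1
  rw [Finset.prod_comm' (t' := univ) (s' := fun i => Ioi i)]
  · exact prod_congr rfl fun i _ => prod_congr rfl fun j _ => hf _ _
  · simp

lemma vdm_eq_det {n : ℕ} (x : Fin n → ℝ) : vdm x = (Matrix.vandermonde x).det :=
  (Matrix.det_vandermonde x).symm

lemma vdm_pos {n : ℕ} {x : Fin n → ℝ} (hx : StrictMono x) : 0 < vdm x :=
  prod_pos fun i _ => prod_pos fun j hj => sub_pos.2 (hx (by simpa using hj))

lemma prod_prod_erase_abs {n : ℕ} (x : Fin n → ℝ) :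
    ∏ j, ∏ k ∈ univ.erase j, |x j - x k| = vdm x ^ 2 := by
  rw [prod_prod_erase_eq_sq (fun i j => |x i - x j|) (fun i j => abs_sub_comm _ _), vdm,
    ← sq_abs (∏ i, ∏ j ∈ Ioi i, (x j - x i))]
  simp_rw [abs_prod, abs_sub_comm]

/-- The matrix of values at `a j` of the node polynomials of `x` with the `i`-th node removed. -/
def nodeMatrix {n : ℕ} (a x : Fin n → ℝ) : Matrix (Fin n) (Fin n) ℝ :=
  .of fun j i => ∏ l ∈ univ.erase i, (a j - x l)

lemma nodeMatrix_eq_vandermonde_mul {n : ℕ} (a x : Fin n → ℝ) :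
    nodeMatrix a x = Matrix.vandermonde a *
      .of fun k i => (Lagrange.nodal (univ.erase i) x).coeff (k : ℕ) := by
  ext j i
  simp only [nodeMatrix, Matrix.of_apply, Matrix.mul_apply, Matrix.vandermonde_apply]
  rw [← Lagrange.eval_nodal, Polynomial.eval_eq_sum_range' (n := n), Finset.sum_range]
  · exact sum_congr rfl fun k _ => mul_comm _ _
  · rw [Lagrange.natDegree_nodal, card_erase_of_mem (mem_univ _), card_univ, Fintype.card_fin]
    have := i.pos
    lia

lemma abs_det_nodeMatrix {n : ℕ} (a : Fin n → ℝ) {x : Fin n → ℝ} (hx : StrictMono x) :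
    |(nodeMatrix a x).det| = |vdm a| * vdm x := by
  have hdiag : nodeMatrix x x = Matrix.diagonal fun i => ∏ l ∈ univ.erase i, (x i - x l) := by
    ext j i
    by_cases h : j = i
    · subst h; simp [nodeMatrix]
    · rw [Matrix.diagonal_apply_ne _ h]
      exact prod_eq_zero (mem_erase.2 ⟨h, mem_univ j⟩) (sub_self _)
  have h1 := congrArg (fun M => |Matrix.det M|) hdiag
  simp only [nodeMatrix_eq_vandermonde_mul, Matrix.det_mul, Matrix.det_diagonal, abs_mul,
    ← vdm_eq_det, abs_prod, prod_prod_erase_abs, abs_of_pos (vdm_pos hx), sq] at h1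
  rw [nodeMatrix_eq_vandermonde_mul, Matrix.det_mul, abs_mul, ← vdm_eq_det,
    mul_left_cancel₀ (vdm_pos hx).ne' h1]

/-- The weights of the partial fraction expansion of `∏ (t - x i) / ∏ (t - a j)`, with sign
reversed. -/
noncomputable def wt {n : ℕ} (a x : Fin n → ℝ) (j : Fin n) : ℝ :=
  -(∏ i, (a j - x i)) / ∏ k ∈ univ.erase j, (a j - a k)

/-- The points `x` interlacing `a` from above, the last one being unbounded. -/
def interlace {n : ℕ} (a : Fin n → ℝ) : Set (Fin n → ℝ) :=
  {x | ∀ i, a i < x i ∧ ∀ j, i < j → x i < a j}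

lemma interlace_strictMono {n : ℕ} {a x : Fin n → ℝ} (hx : x ∈ interlace a) : StrictMono x :=
  fun i j hij => ((hx i).2 j hij).trans (hx j).1

lemma wt_eq {n : ℕ} (a x : Fin n → ℝ) (j : Fin n) :
    wt a x j = (x j - a j) * ∏ i ∈ univ.erase j, (a j - x i) / (a j - a i) := by
  rw [wt, ← mul_prod_erase univ _ (mem_univ j), prod_div_distrib]
  ring

lemma wt_pos {n : ℕ} {a x : Fin n → ℝ} (ha : StrictMono a) (hx : x ∈ interlace a) (j : Fin n) :
    0 < wt a x j := by
  rw [wt_eq]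
  refine mul_pos (sub_pos.2 (hx j).1) (prod_pos fun i hi => ?_)
  rcases lt_or_gt_of_ne (ne_of_mem_erase hi) with h | h
  · exact div_pos (sub_pos.2 ((hx i).2 j h)) (sub_pos.2 (ha h))
  · exact div_pos_of_neg_of_neg (sub_neg.2 ((ha h).trans (hx i).1)) (sub_neg.2 (ha h))

lemma degree_nodal_sub_lt {n : ℕ} (x a : Fin n → ℝ) :
    (Lagrange.nodal univ x - Lagrange.nodal univ a).degree < #(univ : Finset (Fin n)) := by
  rw [← Lagrange.degree_nodal (s := univ) (v := x)]
  apply Polynomial.degree_sub_lt_left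
  · rw [Lagrange.degree_nodal, Lagrange.degree_nodal]
  · exact Lagrange.nodal_ne_zero
  · rw [Lagrange.nodal_monic.leadingCoeff, Lagrange.nodal_monic.leadingCoeff]

lemma eval_nodal_sub {n : ℕ} (a x : Fin n → ℝ) (j : Fin n) :
    (Lagrange.nodal univ x - Lagrange.nodal univ a).eval (a j) = ∏ i, (a j - x i) := by
  rw [Polynomial.eval_sub, Lagrange.eval_nodal, Lagrange.eval_nodal,
    prod_eq_zero (i := j) (f := fun i => a j - a i) (mem_univ j) (sub_self (a j)), sub_zero]

lemma sum_wt {n : ℕ} {a : Fin n → ℝ} (ha : StrictMono a) (x : Fin n → ℝ) :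
    ∑ j, wt a x j = ∑ i, x i - ∑ i, a i := by
  rcases n.eq_zero_or_pos with rfl | hn
  · simp
  have h := Lagrange.coeff_eq_sum (s := univ) (v := a) ha.injective.injOn
    (degree_nodal_sub_lt x a)
  simp only [eval_nodal_sub] at h
  rw [Polynomial.coeff_sub, Lagrange.nodal_eq, Lagrange.nodal_eq,
    Polynomial.prod_X_sub_C_coeff_card_pred _ _ (by simpa using hn),
    Polynomial.prod_X_sub_C_coeff_card_pred _ _ (by simpa using hn)] at h
  simp only [wt, neg_div, sum_neg_distrib, ← h]
  ring

lemma prod_sub_eq {n : ℕ} {a : Fin n → ℝ} (ha : StrictMono a) (x : Fin n → ℝ) (t : ℝ) :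
    ∏ i, (t - x i) = ∏ j, (t - a j) - ∑ j, wt a x j * ∏ k ∈ univ.erase j, (t - a k) := by
  have h := congrArg (Polynomial.eval t) (Lagrange.eq_interpolate (s := univ) (v := a)
    ha.injective.injOn (degree_nodal_sub_lt x a))
  simp only [Polynomial.eval_sub, Lagrange.eval_nodal, Lagrange.interpolate_apply,
    Polynomial.eval_finsetSum, Polynomial.eval_mul, Polynomial.eval_C] at h
  rw [sub_eq_iff_eq_add] at h
  rw [h, add_comm, sub_eq_add_neg, ← sum_neg_distrib]
  congr 1
  refine sum_congr rfl fun j _ => ?_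
  have := eval_nodal_sub a x j
  simp only [Polynomial.eval_sub, Lagrange.eval_nodal] at this
  rw [this, Lagrange.basis, Polynomial.eval_prod, wt]
  simp only [Lagrange.basisDivisor, Polynomial.eval_mul, Polynomial.eval_C, Polynomial.eval_sub,
    Polynomial.eval_X, prod_mul_distrib, prod_inv_distrib]
  ring

lemma prod_sub_div_eq {n : ℕ} {a : Fin n → ℝ} (ha : StrictMono a) (x : Fin n → ℝ) {t : ℝ}
    (ht : ∀ j, t ≠ a j) :
    ∏ i, (t - x i) = (∏ j, (t - a j)) * (1 - ∑ j, wt a x j / (t - a j)) := by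
  rw [prod_sub_eq ha, mul_sub, mul_one, mul_sum]
  congr 1
  refine sum_congr rfl fun j _ => ?_
  rw [← mul_prod_erase univ _ (mem_univ j)]
  have := sub_ne_zero.2 (ht j)
  field_simp

lemma strictMono_eq_of_range_eq {n : ℕ} {x y : Fin n → ℝ} (hx : StrictMono x) (hy : StrictMono y)
    (h : Set.range x = Set.range y) : x = y :=
  hx.range_inj hy |>.1 h

lemma wt_injOn {n : ℕ} {a : Fin n → ℝ} (ha : StrictMono a) : Set.InjOn (wt a) (interlace a) := by
  intro x hx y hy h
  refine strictMono_eq_of_range_eq (interlace_strictMono hx) (interlace_strictMono hy) ?_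
  ext t
  have : ∏ i, (t - x i) = ∏ i, (t - y i) := by rw [prod_sub_eq ha x, prod_sub_eq ha y, h]
  have h2 : (∏ i, (t - x i) = 0) = (∏ i, (t - y i) = 0) := by rw [this]
  simpa [prod_eq_zero_iff, sub_eq_zero, eq_comm (a := t)] using h2

/-- The open positive orthant. -/
def orthant (n : ℕ) : Set (Fin n → ℝ) := {x | ∀ i, 0 < x i}

lemma exists_root_between {n : ℕ} {a : Fin n → ℝ} (ha : StrictMono a) {w : Fin n → ℝ}
    (hw : w ∈ orthant n) {Q : Polynomial ℝ} (hQ : Q.Monic) (hdeg : Q.natDegree = n)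
    (hQa : ∀ j, Q.eval (a j) = -(w j * ∏ k ∈ univ.erase j, (a j - a k))) (i : Fin n) :
    ∃ t, (a i < t ∧ ∀ j, i < j → t < a j) ∧ Q.eval t = 0 := by
  obtain ⟨m, rfl⟩ : ∃ m, n = m + 1 := ⟨n - 1, by have := i.pos; lia⟩
  rcases Fin.eq_castSucc_or_eq_last i with ⟨k, rfl⟩ | rfl
  · have hlt : a k.castSucc < a k.succ := ha Fin.castSucc_lt_succ
    have hne : k.castSucc ≠ k.succ := Fin.castSucc_lt_succ.ne
    have hneg : Q.eval (a k.castSucc) * Q.eval (a k.succ) < 0 := by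
      rw [hQa, hQa, ← mul_prod_erase (univ.erase k.castSucc) _ (mem_erase.2 ⟨hne.symm, mem_univ _⟩),
        ← mul_prod_erase (univ.erase k.succ) _ (mem_erase.2 ⟨hne, mem_univ _⟩),
        erase_right_comm (a := k.castSucc)]
      have h1 : 0 < ∏ l ∈ (univ.erase k.succ).erase k.castSucc,
          ((a k.castSucc - a l) * (a k.succ - a l)) := by
        refine prod_pos fun l hl => ?_
        simp only [mem_erase, mem_univ, and_true] at hl
        rcases lt_or_gt_of_ne hl.1 with h | h
        · exact mul_pos (sub_pos.2 (ha h)) (sub_pos.2 ((ha h).trans hlt))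
        · have h' : k.succ < l := lt_of_le_of_ne (Fin.castSucc_lt_iff_succ_le.1 h) (Ne.symm hl.2)
          exact mul_pos_of_neg_of_neg (sub_neg.2 (ha h)) (sub_neg.2 (ha h'))
      rw [prod_mul_distrib] at h1
      have h2 := mul_pos (mul_pos (hw k.castSucc) (hw k.succ)) h1
      have h3 := mul_pos h2 (mul_pos (sub_pos.2 hlt) (sub_pos.2 hlt))
      linarith
    have hcont : ContinuousOn (fun t => Q.eval t) (Set.Icc (a k.castSucc) (a k.succ)) :=
      Q.continuous.continuousOn
    obtain ⟨t, ht, h0⟩ : ∃ t ∈ Set.Ioo (a k.castSucc) (a k.succ), Q.eval t = 0 := by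
      rcases mul_neg_iff.1 hneg with ⟨h1, h2⟩ | ⟨h1, h2⟩
      · exact intermediate_value_Ioo' hlt.le hcont ⟨h2, h1⟩
      · exact intermediate_value_Ioo hlt.le hcont ⟨h1, h2⟩
    exact ⟨t, ⟨ht.1, fun j hj => ht.2.trans_le
      (ha.monotone (Fin.castSucc_lt_iff_succ_le.1 hj))⟩, h0⟩
  · have hneg : Q.eval (a (Fin.last m)) < 0 := by
      rw [hQa, neg_lt_zero]
      refine mul_pos (hw _) (prod_pos fun k hk => sub_pos.2 (ha ?_))
      exact lt_of_le_of_ne (Fin.le_last k) (ne_of_mem_erase hk)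
    have htop := Q.tendsto_atTop_of_leadingCoeff_nonneg
      (Polynomial.natDegree_pos_iff_degree_pos.1 (by lia)) (by simp [hQ.leadingCoeff])
    obtain ⟨T, hT, hT'⟩ := ((htop.eventually_gt_atTop 0).and
      (Filter.eventually_gt_atTop (a (Fin.last m)))).exists
    obtain ⟨t, ht, h0⟩ := intermediate_value_Ioo hT'.le Q.continuous.continuousOn ⟨hneg, hT⟩
    exact ⟨t, ⟨ht.1, fun j hj => absurd hj (Fin.le_last j).not_gt⟩, h0⟩

lemma wt_surjOn {n : ℕ} {a : Fin n → ℝ} (ha : StrictMono a) :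
    Set.SurjOn (wt a) (interlace a) (orthant n) := by
  intro w hw
  set r : Fin n → ℝ := fun j => w j * ∏ k ∈ univ.erase j, (a j - a k)
  set P := Lagrange.interpolate univ a r
  have hP : P.degree < (Lagrange.nodal univ a).degree := by
    rw [Lagrange.degree_nodal]
    exact Lagrange.degree_interpolate_lt r ha.injective.injOn
  have hPa : ∀ j, P.eval (a j) = r j := fun j =>
    Lagrange.eval_interpolate_at_node r ha.injective.injOn (mem_univ j)
  have hnodal : ∀ j, (Lagrange.nodal univ a).eval (a j) = 0 := fun j =>
    Lagrange.eval_nodal_at_node (mem_univ j)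
  have hroot := exists_root_between ha hw (Q := Lagrange.nodal univ a - P)
    (Lagrange.nodal_monic.sub_of_left hP)
    (by rw [Polynomial.natDegree_eq_of_degree_eq (Polynomial.degree_sub_eq_left_of_degree_lt hP),
          Lagrange.natDegree_nodal, card_univ, Fintype.card_fin])
    (fun j => by rw [Polynomial.eval_sub, hnodal, hPa, zero_sub])
  choose x hx hx0 using hroot
  have hxa : x ∈ interlace a := hx
  refine ⟨x, hxa, ?_⟩
  have hzero : Lagrange.nodal univ x - Lagrange.nodal univ a + P = 0 := by
    refine Polynomial.eq_zero_of_degree_lt_of_eval_index_eq_zero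
      (s := univ) (v := x) (interlace_strictMono hxa).injective.injOn ?_ ?_
    · refine (Polynomial.degree_add_le _ _).trans_lt (max_lt (degree_nodal_sub_lt x a) ?_)
      rwa [Lagrange.degree_nodal] at hP
    · intro i _
      have h1 := hx0 i
      have h2 : (Lagrange.nodal univ x).eval (x i) = 0 :=
        Lagrange.eval_nodal_at_node (mem_univ i)
      simp only [Polynomial.eval_sub, Polynomial.eval_add] at h1 ⊢
      linarith
  funext j
  have h := congrArg (Polynomial.eval (a j)) hzero
  rw [Polynomial.eval_add, eval_nodal_sub, hPa, Polynomial.eval_zero] at h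
  have hA : ∏ k ∈ univ.erase j, (a j - a k) ≠ 0 := prod_ne_zero_iff.2 fun k hk =>
    sub_ne_zero.2 (ha.injective.ne (ne_of_mem_erase hk).symm)
  rw [wt, div_eq_iff hA]
  simp only [r] at h
  linarith

lemma wt_image_interlace {n : ℕ} {a : Fin n → ℝ} (ha : StrictMono a) :
    wt a '' interlace a = orthant n :=
  Set.Subset.antisymm (Set.image_subset_iff.2 fun _ hx j => wt_pos ha hx j) (wt_surjOn ha)

lemma isOpen_interlace {n : ℕ} (a : Fin n → ℝ) : IsOpen (interlace a) := by
  simp only [interlace, Set.ofPred_forall, Set.ofPred_and]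
  refine isOpen_iInter_of_finite fun i => (isOpen_lt (by fun_prop) (by fun_prop)).inter ?_
  exact isOpen_iInter_of_finite fun j => isOpen_iInter_of_finite fun _ =>
    isOpen_lt (by fun_prop) (by fun_prop)

lemma isOpen_orthant (n : ℕ) : IsOpen (orthant n) := by
  simp only [orthant, Set.ofPred_forall]
  exact isOpen_iInter_of_finite fun i => isOpen_lt (by fun_prop) (by fun_prop)

/-- The derivative of `wt a` at `x`. -/
noncomputable def wtDeriv {n : ℕ} (a x : Fin n → ℝ) : (Fin n → ℝ) →L[ℝ] (Fin n → ℝ) :=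
  LinearMap.toContinuousLinearMap (Matrix.toLin'
    (Matrix.diagonal (fun j => (∏ k ∈ univ.erase j, (a j - a k))⁻¹) * nodeMatrix a x))

lemma hasFDerivAt_wt {n : ℕ} (a x : Fin n → ℝ) : HasFDerivAt (wt a) (wtDeriv a x) x := by
  rw [hasFDerivAt_pi']
  intro j
  have h1 : ∀ i ∈ (univ : Finset (Fin n)), HasFDerivAt (fun y : Fin n → ℝ => a j - y i)
      (-(ContinuousLinearMap.proj (R := ℝ) (φ := fun _ : Fin n => ℝ) i)) x := fun i _ =>
    (hasFDerivAt_apply i x).const_sub (a j)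
  have h2 := ((HasFDerivAt.finsetProd h1).neg).mul_const (∏ k ∈ univ.erase j, (a j - a k))⁻¹
  refine h2.congr_fderiv ?_
  ext v
  simp [wtDeriv, Matrix.mulVec, dotProduct, nodeMatrix, mul_sum, mul_assoc]

lemma abs_det_wtDeriv {n : ℕ} {a x : Fin n → ℝ} (ha : StrictMono a) (hx : StrictMono x) :
    |(wtDeriv a x).det| = (vdm a)⁻¹ * vdm x := by
  have h : (wtDeriv a x).det = (∏ j, (∏ k ∈ univ.erase j, (a j - a k))⁻¹) *
      (nodeMatrix a x).det := by
    rw [wtDeriv, ContinuousLinearMap.det, LinearMap.coe_toContinuousLinearMap,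
      LinearMap.det_toLin', Matrix.det_mul, Matrix.det_diagonal]
  rw [h, abs_mul, abs_det_nodeMatrix a hx, prod_inv_distrib, abs_inv, abs_prod]
  simp_rw [abs_prod]
  rw [prod_prod_erase_abs, abs_of_pos (vdm_pos ha)]
  have := (vdm_pos ha).ne'
  field_simp

theorem integral_interlace {n : ℕ} {a : Fin n → ℝ} (ha : StrictMono a) (G : (Fin n → ℝ) → ℂ) :
    ∫ x in interlace a, (vdm x : ℂ) * G (wt a x) = vdm a * ∫ w in orthant n, G w := by
  rw [← wt_image_interlace ha, integral_image_eq_integral_abs_det_fderiv_smul volume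
    (isOpen_interlace a).measurableSet (fun x _ => (hasFDerivAt_wt a x).hasFDerivWithinAt)
    (wt_injOn ha), ← integral_const_mul]
  refine setIntegral_congr_fun (isOpen_interlace a).measurableSet fun x hx => ?_
  have := ofReal_ne_zero.2 (vdm_pos ha).ne'
  simp only [abs_det_wtDeriv ha (interlace_strictMono hx), real_smul]
  push_cast
  field_simp

theorem integrableOn_interlace {n : ℕ} {a : Fin n → ℝ} (ha : StrictMono a)
    {G : (Fin n → ℝ) → ℂ} (hG : IntegrableOn G (orthant n)) :
    IntegrableOn (fun x => (vdm x : ℂ) * G (wt a x)) (interlace a) := by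
  rw [← wt_image_interlace ha, integrableOn_image_iff_integrableOn_abs_det_fderiv_smul volume
    (isOpen_interlace a).measurableSet (fun x _ => (hasFDerivAt_wt a x).hasFDerivWithinAt)
    (wt_injOn ha)] at hG
  refine IntegrableOn.congr_fun (hG.const_mul (vdm a : ℂ)) (fun x hx => ?_)
    (isOpen_interlace a).measurableSet
  have := ofReal_ne_zero.2 (vdm_pos ha).ne'
  simp only [abs_det_wtDeriv ha (interlace_strictMono hx), real_smul]
  push_cast
  field_simp

lemma ofReal_prod_cpow {ι : Type*} (s : Finset ι) {f : ι → ℝ} (hf : ∀ i ∈ s, 0 ≤ f i) (c : ℂ) :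
    ((∏ i ∈ s, f i : ℝ) : ℂ) ^ c = ∏ i ∈ s, (f i : ℂ) ^ c := by
  classical
  induction s using Finset.induction_on with
  | empty => simp
  | insert i s hi ih =>
    rw [prod_insert hi, prod_insert hi, ofReal_mul, mul_cpow_ofReal_nonneg
      (hf i (mem_insert_self i s)) (prod_nonneg fun j hj => hf j (mem_insert_of_mem hj)),
      ih fun j hj => hf j (mem_insert_of_mem hj)]

lemma cpow_finsetSum {ι : Type*} {s : Finset ι} {c : ℂ} (hc : c ≠ 0) (f : ι → ℂ) :
    c ^ (∑ i ∈ s, f i) = ∏ i ∈ s, c ^ f i := by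
  simp only [cpow_def_of_ne_zero hc, mul_sum, Complex.exp_sum]

lemma orthant_eq_pi (n : ℕ) : orthant n = Set.univ.pi fun _ => Set.Ioi 0 := by
  ext x
  simp [orthant]

lemma volume_restrict_orthant (n : ℕ) : (volume : Measure (Fin n → ℝ)).restrict (orthant n) =
    Measure.pi fun _ => volume.restrict (Set.Ioi 0) := by
  rw [orthant_eq_pi, volume_pi, Measure.restrict_pi_pi]

lemma integral_orthant_prod {n : ℕ} (f : Fin n → ℝ → ℂ) :
    ∫ x in orthant n, ∏ i, f i (x i) = ∏ i, ∫ t in Set.Ioi 0, f i t := by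
  rw [volume_restrict_orthant]
  exact integral_fintype_prod_eq_prod f

lemma integrableOn_orthant_prod {n : ℕ} {f : Fin n → ℝ → ℂ}
    (hf : ∀ i, IntegrableOn (f i) (Set.Ioi 0)) :
    IntegrableOn (fun x => ∏ i, f i (x i)) (orthant n) := by
  rw [IntegrableOn, volume_restrict_orthant]
  exact Integrable.fintype_prod_dep hf

/-- The density of the Gamma distribution of shape `s`, up to normalization. -/
noncomputable def gammaKernel (s : ℂ) (t : ℝ) : ℂ := Complex.exp (-t) * (t : ℂ) ^ (s - 1)

lemma integrableOn_gammaKernel {s : ℂ} (hs : 0 < s.re) :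
    IntegrableOn (gammaKernel s) (Set.Ioi 0) := by
  have := Complex.GammaIntegral_convergent hs
  refine this.congr_fun (fun t _ => ?_) measurableSet_Ioi
  simp [gammaKernel]

lemma integral_gammaKernel {s : ℂ} (hs : 0 < s.re) :
    ∫ t in Set.Ioi 0, gammaKernel s t = Complex.Gamma s := by
  rw [Complex.Gamma_eq_integral hs, Complex.GammaIntegral]
  refine setIntegral_congr_fun measurableSet_Ioi fun t _ => ?_
  simp [gammaKernel]

/-- The open region above the hyperplane `∑ v = 0` in the orthant times the line. -/
def simplexRegion (n : ℕ) (c : ℝ) : Set (Fin n → ℝ) := {v | v ∈ orthant n ∧ ∑ i, v i < c}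

lemma measurableSet_simplexRegion (n : ℕ) (c : ℝ) : MeasurableSet (simplexRegion n c) :=
  (isOpen_orthant n).measurableSet.inter
    (measurableSet_lt (f := fun v : Fin n → ℝ => ∑ i, v i) (by fun_prop) measurable_const)

/-- The integrand of the Dirichlet integral over the simplex of size `c`. -/
noncomputable def dirichletKernel {n : ℕ} (s : Fin n → ℂ) (t : ℂ) (c : ℝ) (v : Fin n → ℝ) : ℂ :=
  (∏ i, (v i : ℂ) ^ (s i - 1)) * ((c - ∑ i, v i : ℝ) : ℂ) ^ (t - 1)

lemma smul_mem_simplexRegion {n : ℕ} {c : ℝ} (hc : 0 < c) (v : Fin n → ℝ) :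
    c • v ∈ simplexRegion n c ↔ v ∈ simplexRegion n 1 := by
  simp only [simplexRegion, orthant, Set.mem_ofPred_eq, Pi.smul_apply, smul_eq_mul, ← mul_sum,
    mul_pos_iff_of_pos_left hc]
  rw [← lt_div_iff₀' hc, div_self hc.ne']

lemma integral_dirichletKernel_eq_scale {n : ℕ} (s : Fin n → ℂ) (t : ℂ) {c : ℝ} (hc : 0 < c) :
    ∫ v in simplexRegion n c, dirichletKernel s t c v =
      (c : ℂ) ^ (∑ i, s i + t - 1) * ∫ v in simplexRegion n 1, dirichletKernel s t 1 v := by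
  have h := Measure.integral_comp_smul (volume : Measure (Fin n → ℝ))
    ((simplexRegion n c).indicator (dirichletKernel s t c)) c
  rw [integral_indicator (measurableSet_simplexRegion n c)] at h
  have hcn : |(c ^ Module.finrank ℝ (Fin n → ℝ))⁻¹| = (c ^ n)⁻¹ := by
    rw [Module.finrank_fin_fun, abs_of_pos (by positivity)]
  have hc0 : (c : ℂ) ≠ 0 := ofReal_ne_zero.2 hc.ne'
  rw [hcn, eq_comm, inv_smul_eq_iff₀ (by positivity)] at h
  rw [h, real_smul, ← integral_indicator (measurableSet_simplexRegion n 1), ← integral_const_mul,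
    ← integral_const_mul]
  congr 1
  funext v
  by_cases hv : v ∈ simplexRegion n 1
  · rw [Set.indicator_of_mem ((smul_mem_simplexRegion hc v).2 hv), Set.indicator_of_mem hv]
    have h1 : c - ∑ i, (c • v) i = c * (1 - ∑ i, v i) := by
      simp [← mul_sum, mul_sub]
    have h2 : (0 : ℝ) ≤ 1 - ∑ i, v i := sub_nonneg.2 hv.2.le
    have h3 : (c : ℂ) ^ (∑ i, s i + t - 1) =
        (c : ℂ) ^ n * ((∏ i, (c : ℂ) ^ (s i - 1)) * (c : ℂ) ^ (t - 1)) := by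
      rw [← cpow_finsetSum hc0 fun i => s i - 1, ← cpow_natCast, ← cpow_add _ _ hc0, ← cpow_add _ _ hc0]
      congr 1
      simp
      ring
    have h4 : ∀ i, (((c • v) i : ℝ) : ℂ) ^ (s i - 1) =
        (c : ℂ) ^ (s i - 1) * (v i : ℂ) ^ (s i - 1) := fun i => by
      rw [Pi.smul_apply, smul_eq_mul, ofReal_mul, mul_cpow_ofReal_nonneg hc.le (hv.1 i).le]
    simp only [dirichletKernel, h1, h3, h4, prod_mul_distrib]
    rw [ofReal_mul, mul_cpow_ofReal_nonneg hc.le h2]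
    push_cast
    ring
  · rw [Set.indicator_of_notMem (mt (smul_mem_simplexRegion hc v).1 hv),
      Set.indicator_of_notMem hv, mul_zero, mul_zero]

theorem dirichlet_integral {n : ℕ} {s : Fin n → ℂ} (hs : ∀ i, 0 < (s i).re) {t : ℂ}
    (ht : 0 < t.re) :
    (∫ v in simplexRegion n 1, dirichletKernel s t 1 v) * Complex.Gamma (∑ i, s i + t) =
      (∏ i, Complex.Gamma (s i)) * Complex.Gamma t := by
  set K : (Fin n → ℝ) × ℝ → ℂ := fun p =>
    (orthant n).indicator (fun v => ∏ i, gammaKernel (s i) (v i)) p.1 *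
      (Set.Ioi 0).indicator (gammaKernel t) p.2 with hK
  have hKint : Integrable K := Integrable.mul_prod
    ((integrableOn_orthant_prod fun i => integrableOn_gammaKernel (hs i)).integrable_indicator
      (isOpen_orthant n).measurableSet)
    ((integrableOn_gammaKernel ht).integrable_indicator measurableSet_Ioi)
  have hT : MeasurePreserving (fun p : (Fin n → ℝ) × ℝ => (p.1, p.2 - ∑ i, p.1 i)) :=
    (MeasurePreserving.id volume).skew_product (g := fun (v : Fin n → ℝ) (c : ℝ) => c - ∑ i, v i)
      (by fun_prop) (Filter.Eventually.of_forall fun v =>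
        (measurePreserving_sub_right volume (∑ i, v i)).map_eq)
  have hH : Integrable (fun p : (Fin n → ℝ) × ℝ => K (p.1, p.2 - ∑ i, p.1 i)) :=
    hT.integrable_comp_of_integrable hKint
  have hHK : ∫ p : (Fin n → ℝ) × ℝ, K (p.1, p.2 - ∑ i, p.1 i) =
      (∏ i, Complex.Gamma (s i)) * Complex.Gamma t := by
    rw [← integral_map (φ := fun p : (Fin n → ℝ) × ℝ => (p.1, p.2 - ∑ i, p.1 i)) (f := K)
      hT.aemeasurable (by rw [hT.map_eq]; exact hKint.aestronglyMeasurable), hT.map_eq, hK,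
      Measure.volume_eq_prod, integral_prod_mul,
      integral_indicator (isOpen_orthant n).measurableSet, integral_indicator measurableSet_Ioi,
      integral_orthant_prod, integral_gammaKernel ht]
    simp_rw [integral_gammaKernel (hs _)]
  rw [← hHK, Measure.volume_eq_prod, integral_prod_symm _ hH]
  have hsum : 0 < (∑ i, s i + t).re := by
    rw [add_re, re_sum]
    have := sum_nonneg fun i (_ : i ∈ univ) => (hs i).le
    positivity
  rw [← integral_gammaKernel hsum, ← integral_const_mul, ← integral_indicator measurableSet_Ioi]
  congr 1
  funext c
  have hslice : ∀ v, K (v, c - ∑ i, v i) =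
      Complex.exp (-c) * (simplexRegion n c).indicator (dirichletKernel s t c) v := by
    intro v
    by_cases hv : v ∈ orthant n
    · by_cases hc : ∑ i, v i < c
      · rw [hK]
        simp only
        rw [Set.indicator_of_mem hv, Set.indicator_of_mem (Set.mem_Ioi.2 (sub_pos.2 hc)),
          Set.indicator_of_mem (show v ∈ simplexRegion n c from ⟨hv, hc⟩)]
        have : Complex.exp (-c) =
            (∏ i, Complex.exp (-(v i : ℂ))) * Complex.exp (-((c - ∑ i, v i : ℝ) : ℂ)) := by
          rw [← Complex.exp_sum, ← Complex.exp_add, sum_neg_distrib]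
          push_cast
          ring_nf
        simp only [gammaKernel, dirichletKernel, prod_mul_distrib, this]
        ring
      · rw [hK, Set.indicator_of_notMem (s := simplexRegion n c) (fun h => hc h.2)]
        simp only
        rw [Set.indicator_of_notMem (s := Set.Ioi (0 : ℝ))
          (fun h => hc (sub_pos.1 h)), mul_zero, mul_zero]
    · rw [hK, Set.indicator_of_notMem (s := simplexRegion n c) (fun h => hv h.1)]
      simp only
      rw [Set.indicator_of_notMem hv, zero_mul, mul_zero]
  simp_rw [hslice]
  rw [integral_const_mul, integral_indicator (measurableSet_simplexRegion n c)]
  by_cases hc : 0 < c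
  · rw [Set.indicator_of_mem (Set.mem_Ioi.2 hc), integral_dirichletKernel_eq_scale s t hc,
      gammaKernel]
    ring
  · rw [Set.indicator_of_notMem (by simpa using hc)]
    have : simplexRegion n c = ∅ := by
      refine Set.eq_empty_iff_forall_notMem.2 fun v hv => hc ?_
      exact (sum_nonneg fun i _ => (hv.1 i).le).trans_lt hv.2
    simp [this]

/-- The product of the distances `|a j - x i|`, raised to the powers `s j - 1`. -/
noncomputable def cross {m n : ℕ} (a : Fin m → ℝ) (x : Fin n → ℝ) (s : Fin m → ℂ) : ℂ :=
  ∏ j, ∏ i, ((|a j - x i| : ℝ) : ℂ) ^ (s j - 1)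

/-- The product of the distances `|a j - a k|`, `k ≠ j`, raised to the powers `s j - 1`. -/
noncomputable def selfCross {m : ℕ} (a : Fin m → ℝ) (s : Fin m → ℂ) : ℂ :=
  ∏ j, ∏ k ∈ univ.erase j, ((|a j - a k| : ℝ) : ℂ) ^ (s j - 1)

lemma cross_eq {n : ℕ} {a x : Fin n → ℝ} (ha : StrictMono a) (hx : x ∈ interlace a)
    (s : Fin n → ℂ) :
    cross a x s = (∏ j, (wt a x j : ℂ) ^ (s j - 1)) * selfCross a s := by
  rw [cross, selfCross, ← prod_mul_distrib]
  refine prod_congr rfl fun j _ => ?_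
  have hA : ∏ k ∈ univ.erase j, |a j - a k| ≠ 0 := prod_ne_zero_iff.2 fun k hk =>
    abs_ne_zero.2 (sub_ne_zero.2 (ha.injective.ne (ne_of_mem_erase hk).symm))
  have h : ∏ i, |a j - x i| = wt a x j * ∏ k ∈ univ.erase j, |a j - a k| := by
    rw [← abs_of_pos (wt_pos ha hx j), wt, abs_div, abs_neg, abs_prod, abs_prod,
      div_mul_cancel₀ _ hA]
  rw [← ofReal_prod_cpow _ (fun i _ => abs_nonneg _), ← ofReal_prod_cpow _ (fun i _ => abs_nonneg _),
    h, ofReal_mul, mul_cpow_ofReal_nonneg (wt_pos ha hx j).le (prod_nonneg fun i _ => abs_nonneg _)]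

lemma expKernel_eq {n : ℕ} {a x : Fin n → ℝ} (ha : StrictMono a) (hx : x ∈ interlace a)
    (s : Fin n → ℂ) :
    (vdm x : ℂ) * cross a x s * Complex.exp (-∑ i, (x i : ℂ)) =
      selfCross a s * Complex.exp (-∑ i, (a i : ℂ)) *
        ((vdm x : ℂ) * ∏ j, gammaKernel (s j) (wt a x j)) := by
  have h : Complex.exp (-∑ i, (x i : ℂ)) =
      Complex.exp (-∑ i, (a i : ℂ)) * ∏ j, Complex.exp (-(wt a x j : ℂ)) := by
    rw [← Complex.exp_sum, ← Complex.exp_add, sum_neg_distrib, ← ofReal_sum univ (wt a x),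
      sum_wt ha]
    push_cast
    ring_nf
  simp only [cross_eq ha hx, h, gammaKernel, prod_mul_distrib]
  ring

lemma integrableOn_interlace_exp {n : ℕ} {a : Fin n → ℝ} (ha : StrictMono a) {s : Fin n → ℂ}
    (hs : ∀ j, 0 < (s j).re) :
    IntegrableOn (fun x => (vdm x : ℂ) * cross a x s * Complex.exp (-∑ i, (x i : ℂ)))
      (interlace a) := by
  have h := (integrableOn_interlace ha (integrableOn_orthant_prod fun j =>
    integrableOn_gammaKernel (hs j))).const_mul
      (selfCross a s * Complex.exp (-∑ i, (a i : ℂ)))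
  exact IntegrableOn.congr_fun h (fun x hx => (expKernel_eq ha hx s).symm)
    (isOpen_interlace a).measurableSet

theorem integral_interlace_exp {n : ℕ} {a : Fin n → ℝ} (ha : StrictMono a) {s : Fin n → ℂ}
    (hs : ∀ j, 0 < (s j).re) :
    ∫ x in interlace a, (vdm x : ℂ) * cross a x s * Complex.exp (-∑ i, (x i : ℂ)) =
      (∏ j, Complex.Gamma (s j)) *
        (vdm a * selfCross a s * Complex.exp (-∑ i, (a i : ℂ))) := by
  rw [setIntegral_congr_fun (isOpen_interlace a).measurableSet fun x hx => expKernel_eq ha hx s,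
    integral_const_mul, integral_interlace ha fun w => ∏ j, gammaKernel (s j) (w j),
    integral_orthant_prod fun j => gammaKernel (s j)]
  simp_rw [integral_gammaKernel (hs _)]
  ring

lemma integral_orthant_scale {n : ℕ} {c : Fin n → ℝ} (hc : c ∈ orthant n)
    (g : (Fin n → ℝ) → ℂ) :
    ∫ w in orthant n, g w = (∏ j, (c j : ℂ)) * ∫ u in orthant n, g (fun j => c j * u j) := by
  set L : (Fin n → ℝ) →L[ℝ] (Fin n → ℝ) :=
    LinearMap.toContinuousLinearMap (Matrix.toLin' (Matrix.diagonal c)) with hL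
  have hLapp : ∀ u, L u = fun j => c j * u j := fun u => by
    ext j
    simp [hL, Matrix.mulVec_diagonal]
  have hdet : |L.det| = ∏ j, c j := by
    rw [hL, ContinuousLinearMap.det, LinearMap.coe_toContinuousLinearMap, LinearMap.det_toLin',
      Matrix.det_diagonal, abs_of_pos (prod_pos fun j _ => hc j)]
  have himage : L '' orthant n = orthant n := by
    ext w
    constructor
    · rintro ⟨u, hu, rfl⟩ j
      rw [hLapp]
      exact mul_pos (hc j) (hu j)
    · intro hw
      refine ⟨fun j => w j / c j, fun j => div_pos (hw j) (hc j), ?_⟩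
      rw [hLapp]
      funext j
      exact mul_div_cancel₀ _ (hc j).ne'
  have hinj : Set.InjOn L (orthant n) := fun u _ v _ h => by
    funext j
    rw [hLapp, hLapp] at h
    exact mul_left_cancel₀ (hc j).ne' (congrFun h j)
  conv_lhs => rw [← himage]
  rw [integral_image_eq_integral_abs_det_fderiv_smul volume (isOpen_orthant n).measurableSet
    (fun x _ => L.hasFDerivAt.hasFDerivWithinAt) hinj, ← integral_const_mul]
  simp only [hdet, hLapp, real_smul, ofReal_prod]

lemma forall_lt_iff_sum_wt_lt {n : ℕ} {a x : Fin n → ℝ} (ha : StrictMono a)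
    (hx : x ∈ interlace a) {b : ℝ} (hb : ∀ j, a j < b) :
    (∀ i, x i < b) ↔ ∑ j, wt a x j / (b - a j) < 1 := by
  have h := prod_sub_div_eq ha x (t := b) fun j => (hb j).ne'
  have hpos : 0 < ∏ j, (b - a j) := prod_pos fun j _ => sub_pos.2 (hb j)
  rw [← sub_pos, ← mul_pos_iff_of_pos_left hpos, ← h]
  refine ⟨fun H => prod_pos fun i _ => sub_pos.2 (H i), fun H i => ?_⟩
  by_contra! hi
  have hother : 0 < ∏ k ∈ univ.erase i, (b - x k) := by
    refine prod_pos fun k hk => sub_pos.2 ?_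
    rcases lt_or_gt_of_ne (ne_of_mem_erase hk) with hlt | hlt
    · exact ((hx k).2 i hlt).trans (hb i)
    · exact absurd (((hx i).2 k hlt).trans (hb k)) hi.not_gt
  rw [← mul_prod_erase univ _ (mem_univ i)] at H
  exact absurd (pos_of_mul_pos_left H hother.le) (sub_nonpos.2 hi).not_gt

theorem integral_interlace_lt {n : ℕ} {a : Fin n → ℝ} (ha : StrictMono a) (s : Fin n → ℂ)
    (t : ℂ) {b : ℝ} (hb : ∀ j, a j < b) :
    ∫ x in interlace a ∩ {x | ∀ i, x i < b},
        (vdm x : ℂ) * cross a x s * ∏ i, ((b - x i : ℝ) : ℂ) ^ (t - 1) =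
      (∫ v in simplexRegion n 1, dirichletKernel s t 1 v) *
        (vdm a * selfCross a s * ∏ j, ((b - a j : ℝ) : ℂ) ^ (s j + t - 1)) := by
  set S : Set (Fin n → ℝ) := {w | ∑ j, w j / (b - a j) < 1}
  set G : (Fin n → ℝ) → ℂ := S.indicator fun w =>
    (∏ j, (w j : ℂ) ^ (s j - 1)) * ((1 - ∑ j, w j / (b - a j) : ℝ) : ℂ) ^ (t - 1) with hG
  have hba : ∀ j, 0 < b - a j := fun j => sub_pos.2 (hb j)
  have hmeas : MeasurableSet {x : Fin n → ℝ | ∀ i, x i < b} := by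
    rw [Set.ofPred_forall]
    exact MeasurableSet.iInter fun i => measurableSet_lt (by fun_prop) measurable_const
  have hpoint : ∀ x ∈ interlace a, Set.indicator {x : Fin n → ℝ | ∀ i, x i < b}
      (fun x => (vdm x : ℂ) * cross a x s * ∏ i, ((b - x i : ℝ) : ℂ) ^ (t - 1)) x =
      (selfCross a s * ∏ j, ((b - a j : ℝ) : ℂ) ^ (t - 1)) * ((vdm x : ℂ) * G (wt a x)) := by
    intro x hx
    by_cases hxb : ∀ i, x i < b
    · have hwS : wt a x ∈ S := (forall_lt_iff_sum_wt_lt ha hx hb).1 hxb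
      rw [Set.indicator_of_mem (show x ∈ {x : Fin n → ℝ | ∀ i, x i < b} from hxb), hG,
        Set.indicator_of_mem hwS, cross_eq ha hx,
        ← ofReal_prod_cpow _ (fun i _ => (sub_pos.2 (hxb i)).le),
        prod_sub_div_eq ha x fun j => (hb j).ne', ofReal_mul,
        mul_cpow_ofReal_nonneg (prod_nonneg fun j _ => (hba j).le) (sub_nonneg.2 (le_of_lt hwS)),
        ofReal_prod_cpow _ (fun j _ => (hba j).le)]
      ring
    · have hwS : wt a x ∉ S := mt (forall_lt_iff_sum_wt_lt ha hx hb).2 hxb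
      rw [Set.indicator_of_notMem (show x ∉ {x : Fin n → ℝ | ∀ i, x i < b} from hxb), hG,
        Set.indicator_of_notMem hwS, mul_zero, mul_zero]
  rw [← setIntegral_indicator hmeas,
    setIntegral_congr_fun (isOpen_interlace a).measurableSet hpoint, integral_const_mul,
    integral_interlace ha, integral_orthant_scale (c := fun j => b - a j) hba]
  have hGscale : ∀ u ∈ orthant n, G (fun j => (b - a j) * u j) =
      (∏ j, ((b - a j : ℝ) : ℂ) ^ (s j - 1)) *
        {v : Fin n → ℝ | ∑ i, v i < 1}.indicator (dirichletKernel s t 1) u := by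
    intro u hu
    have hsum : ∑ j, (b - a j) * u j / (b - a j) = ∑ j, u j :=
      sum_congr rfl fun j _ => mul_div_cancel_left₀ _ (hba j).ne'
    by_cases hu1 : ∑ j, u j < 1
    · rw [hG, Set.indicator_of_mem (show (fun j => (b - a j) * u j) ∈ S from hsum.trans_lt hu1),
        Set.indicator_of_mem (show u ∈ {v : Fin n → ℝ | ∑ i, v i < 1} from hu1), hsum,
        dirichletKernel, ← mul_assoc, ← prod_mul_distrib]
      congr 1
      refine prod_congr rfl fun j _ => ?_
      rw [ofReal_mul, mul_cpow_ofReal_nonneg (hba j).le (hu j).le]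
    · rw [hG, Set.indicator_of_notMem
          (show (fun j => (b - a j) * u j) ∉ S from fun h => hu1 (hsum.symm.trans_lt h)),
        Set.indicator_of_notMem (show u ∉ {v : Fin n → ℝ | ∑ i, v i < 1} from hu1), mul_zero]
  rw [setIntegral_congr_fun (isOpen_orthant n).measurableSet hGscale, integral_const_mul,
    setIntegral_indicator (measurableSet_lt (f := fun v : Fin n → ℝ => ∑ i, v i) (by fun_prop)
      measurable_const)]
  have hexp : ∏ j, ((b - a j : ℝ) : ℂ) ^ (s j + t - 1) =
      (∏ j, ((b - a j : ℝ) : ℂ)) * (∏ j, ((b - a j : ℝ) : ℂ) ^ (s j - 1)) *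
        ∏ j, ((b - a j : ℝ) : ℂ) ^ (t - 1) := by
    rw [← prod_mul_distrib, ← prod_mul_distrib]
    refine prod_congr rfl fun j _ => ?_
    have h0 : ((b - a j : ℝ) : ℂ) ≠ 0 := ofReal_ne_zero.2 (hba j).ne'
    rw [show s j + t - 1 = 1 + (s j - 1) + (t - 1) by ring, cpow_add _ _ h0, cpow_add _ _ h0,
      cpow_one]
  rw [hexp, show orthant n ∩ {v : Fin n → ℝ | ∑ i, v i < 1} = simplexRegion n 1 from rfl]
  ring

/-- The open Weyl chamber of type `B_n`. -/
def chamber (n : ℕ) : Set (Fin n → ℝ) := {x | x ∈ orthant n ∧ StrictMono x}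

/-- The integrand of the Laguerre case of the Selberg integral. -/
noncomputable def lag {n : ℕ} (α γ : ℂ) (x : Fin n → ℝ) : ℂ :=
  Complex.exp (-∑ i, (x i : ℂ)) * (∏ i, (x i : ℂ) ^ (α - 1)) * (vdm x : ℂ) ^ (2 * γ)

lemma prod_erase_eq_ite {ι M : Type*} [Fintype ι] [DecidableEq ι] [CommMonoid M] (j : ι)
    (f : ι → M) : ∏ k ∈ univ.erase j, f k = ∏ k, if k = j then 1 else f k := by
  rw [← Finset.filter_ne', prod_filter]
  exact prod_congr rfl fun k _ => by by_cases h : k = j <;> simp [h]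

lemma selfCross_const {n : ℕ} {a : Fin n → ℝ} (ha : StrictMono a) (γ : ℂ) :
    selfCross a (fun _ => γ) = (vdm a : ℂ) ^ (2 * γ - 2) := by
  have h0 : (vdm a : ℂ) ≠ 0 := ofReal_ne_zero.2 (vdm_pos ha).ne'
  have h : selfCross a (fun _ => γ) =
      ((∏ j, ∏ k ∈ univ.erase j, |a j - a k| : ℝ) : ℂ) ^ (γ - 1) := by
    rw [ofReal_prod_cpow _ fun j _ => prod_nonneg fun k _ => abs_nonneg _]
    exact prod_congr rfl fun j _ => (ofReal_prod_cpow _ (fun k _ => abs_nonneg _) _).symm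
  rw [h, prod_prod_erase_abs, sq, ofReal_mul,
    mul_cpow_ofReal_nonneg (vdm_pos ha).le (vdm_pos ha).le, ← cpow_add _ _ h0]
  congr 1
  ring

lemma vdm_cons_zero {m : ℕ} (a : Fin m → ℝ) :
    vdm (Fin.cons 0 a : Fin (m + 1) → ℝ) = (∏ i, a i) * vdm a := by
  simp [vdm, Fin.prod_univ_succ, Fin.prod_Ioi_succ]

lemma vdm_snoc {m : ℕ} (x : Fin (m + 1) → ℝ) :
    vdm x = vdm (Fin.init x) * ∏ j, (x (Fin.last m) - Fin.init x j) := by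
  simp only [vdm]
  rw [Fin.prod_univ_castSucc, ← prod_mul_distrib]
  have h : Ioi (Fin.last m) = ∅ := by ext; simp [Fin.le_last]
  rw [h, prod_empty, mul_one]
  refine prod_congr rfl fun i _ => ?_
  have h2 : Ioi i.castSucc = insert (Fin.last m) ((Ioi i).map Fin.castSuccEmb) := by
    ext k
    rcases Fin.eq_castSucc_or_eq_last k with ⟨l, rfl⟩ | rfl
    · simp [Fin.le_last]
    · simp [Fin.castSucc_lt_last]
  rw [h2, prod_insert (by simp), prod_map, mul_comm]
  rfl

lemma selfCross_cons_zero {m : ℕ} {a : Fin m → ℝ} (ha : a ∈ orthant m) (α γ : ℂ) :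
    selfCross (Fin.cons 0 a : Fin (m + 1) → ℝ) (Fin.cons α fun _ => γ) =
      (∏ i, (a i : ℂ) ^ (α - 1)) * (∏ i, (a i : ℂ) ^ (γ - 1)) * selfCross a fun _ => γ := by
  simp only [selfCross, prod_erase_eq_ite]
  rw [Fin.prod_univ_succ, mul_assoc, ← prod_mul_distrib]
  congr 1
  · rw [Fin.prod_univ_succ]
    simp [Fin.succ_ne_zero, abs_of_pos (ha _)]
  · refine prod_congr rfl fun j _ => ?_
    rw [Fin.prod_univ_succ]
    simp [(Fin.succ_ne_zero _).symm, abs_of_pos (ha _)]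

lemma lag_of_cons_zero {m : ℕ} {a : Fin m → ℝ} (ha : a ∈ chamber m) (α γ : ℂ) :
    (vdm a : ℂ) * (vdm (Fin.cons 0 a : Fin (m + 1) → ℝ) *
      selfCross (Fin.cons 0 a : Fin (m + 1) → ℝ) (Fin.cons α fun _ => γ) *
      Complex.exp (-∑ i, ((Fin.cons 0 a : Fin (m + 1) → ℝ) i : ℂ))) = lag (α + γ) γ a := by
  have h0 : (vdm a : ℂ) ≠ 0 := ofReal_ne_zero.2 (vdm_pos ha.2).ne'
  have h1 : ∏ i, (a i : ℂ) ^ (α + γ - 1) =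
      (∏ i, (a i : ℂ)) * (∏ i, (a i : ℂ) ^ (α - 1)) * ∏ i, (a i : ℂ) ^ (γ - 1) := by
    rw [← prod_mul_distrib, ← prod_mul_distrib]
    refine prod_congr rfl fun i _ => ?_
    have hi : (a i : ℂ) ≠ 0 := ofReal_ne_zero.2 (ha.1 i).ne'
    rw [show α + γ - 1 = 1 + (α - 1) + (γ - 1) by ring, cpow_add _ _ hi, cpow_add _ _ hi,
      cpow_one]
  have h2 : (vdm a : ℂ) ^ (2 * γ) = vdm a * vdm a * (vdm a : ℂ) ^ (2 * γ - 2) := by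
    rw [show 2 * γ = 1 + 1 + (2 * γ - 2) by ring, cpow_add _ _ h0, cpow_add _ _ h0, cpow_one]
    ring_nf
  rw [selfCross_cons_zero ha.1, vdm_cons_zero, selfCross_const ha.2, lag, h1, h2,
    Fin.sum_univ_succ]
  simp only [Fin.cons_zero, Fin.cons_succ, ofReal_zero, zero_add]
  push_cast
  ring

lemma lag_of_init {m : ℕ} {x : Fin (m + 1) → ℝ} (hx : x ∈ chamber (m + 1)) (α γ : ℂ) :
    Complex.exp (-∑ i, (x i : ℂ)) * (∏ i, (x i : ℂ) ^ (α - 1)) * vdm x *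
      (vdm (Fin.init x) * selfCross (Fin.init x) (fun _ => γ) *
        ∏ j : Fin m, ((x (Fin.last m) - Fin.init x j : ℝ) : ℂ) ^ (γ + γ - 1)) = lag α γ x := by
  have hinit : StrictMono (Fin.init x) := fun i j hij => hx.2 (Fin.castSucc_lt_castSucc_iff.2 hij)
  have hlast : ∀ j : Fin m, 0 < x (Fin.last m) - Fin.init x j := fun j =>
    sub_pos.2 (hx.2 (Fin.castSucc_lt_last j))
  have h0 : (vdm (Fin.init x) : ℂ) ≠ 0 := ofReal_ne_zero.2 (vdm_pos hinit).ne'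
  have h1 : (vdm x : ℂ) ≠ 0 := ofReal_ne_zero.2 (vdm_pos hx.2).ne'
  have h2 : (vdm (Fin.init x) : ℂ) * (vdm (Fin.init x) : ℂ) ^ (2 * γ - 2) =
      (vdm (Fin.init x) : ℂ) ^ (γ + γ - 1) := by
    rw [show γ + γ - 1 = 1 + (2 * γ - 2) by ring, cpow_add _ _ h0, cpow_one]
  have h3 : (vdm x : ℂ) * (vdm x : ℂ) ^ (γ + γ - 1) = (vdm x : ℂ) ^ (2 * γ) := by
    rw [show 2 * γ = 1 + (γ + γ - 1) by ring, cpow_add _ _ h1, cpow_one]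
  have h4 : (vdm x : ℂ) ^ (γ + γ - 1) = (vdm (Fin.init x) : ℂ) ^ (γ + γ - 1) *
      ∏ j : Fin m, ((x (Fin.last m) - Fin.init x j : ℝ) : ℂ) ^ (γ + γ - 1) := by
    rw [vdm_snoc, ofReal_mul, mul_cpow_ofReal_nonneg (vdm_pos hinit).le
      (prod_nonneg fun j _ => (hlast j).le), ofReal_prod_cpow _ fun j _ => (hlast j).le]
  rw [selfCross_const hinit, h2, ← h4, lag, ← h3]
  ring

lemma interlace_cons_zero_iff {m : ℕ} (a : Fin m → ℝ) (x : Fin (m + 1) → ℝ) :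
    (a ∈ chamber m ∧ x ∈ interlace (Fin.cons 0 a : Fin (m + 1) → ℝ)) ↔
      (x ∈ chamber (m + 1) ∧ a ∈ interlace (Fin.init x) ∩ {a | ∀ i, a i < x (Fin.last m)}) := by
  constructor
  · rintro ⟨ha, hx⟩
    have hmono := interlace_strictMono hx
    have hsucc : ∀ i : Fin m, a i < x i.succ := fun i => by simpa using (hx i.succ).1
    refine ⟨⟨fun i => ?_, hmono⟩, fun i => ⟨?_, fun j hij => ?_⟩, fun i => ?_⟩
    · refine lt_of_le_of_lt ?_ (hx i).1
      induction i using Fin.cases with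
      | zero => simp
      | succ k => simpa using (ha.1 k).le
    · simpa [Fin.init] using (hx i.castSucc).2 i.succ Fin.castSucc_lt_succ
    · exact (hsucc i).trans_le
        (hmono.monotone (Fin.castSucc_lt_iff_succ_le.1 (Fin.castSucc_lt_castSucc_iff.2 hij)))
    · exact (hsucc i).trans_le (hmono.monotone (Fin.le_last _))
  · rintro ⟨⟨hpos, hmono⟩, ha, hlast⟩
    have ha1 : ∀ i : Fin m, x i.castSucc < a i := fun i => (ha i).1
    refine ⟨⟨fun i => (hpos _).trans (ha1 i), interlace_strictMono ha⟩, fun i => ⟨?_, ?_⟩⟩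
    · induction i using Fin.cases with
      | zero => simpa using hpos 0
      | succ k =>
        rw [Fin.cons_succ]
        rcases Fin.eq_castSucc_or_eq_last k.succ with ⟨l, hl⟩ | hl
        · rw [hl]
          refine (ha k).2 l ?_
          rw [← Fin.castSucc_lt_castSucc_iff, ← hl]
          exact Fin.castSucc_lt_succ
        · rw [hl]
          exact hlast k
    · intro j hij
      induction j using Fin.cases with
      | zero => exact absurd hij (Fin.not_lt_zero i)
      | succ l =>
        rw [Fin.cons_succ]
        exact (hmono.monotone (Fin.le_castSucc_iff.2 hij)).trans_lt (ha1 l)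

lemma measurableSet_chamber (n : ℕ) : MeasurableSet (chamber n) := by
  refine (isOpen_orthant n).measurableSet.inter (s₂ := {x | StrictMono x}) ?_
  simp only [StrictMono, Set.ofPred_forall]
  exact MeasurableSet.iInter fun i => MeasurableSet.iInter fun j => MeasurableSet.iInter fun _ =>
    measurableSet_lt (by fun_prop) (by fun_prop)

@[fun_prop]
lemma measurable_vdm {n : ℕ} : Measurable (vdm (n := n)) := by
  unfold vdm
  fun_prop

@[fun_prop]
lemma measurable_lag {n : ℕ} (α γ : ℂ) : Measurable (lag (n := n) α γ) := by
  unfold lag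
  fun_prop

/-- A product function dominating `lag`. -/
noncomputable def lagBound (n N : ℕ) (α : ℝ) (x : Fin n → ℝ) : ℂ :=
  ∏ i, gammaKernel α (x i) * ((1 + x i : ℝ) : ℂ) ^ (n * N)

lemma integrableOn_lagBound (n N : ℕ) {α : ℝ} (hα : 0 < α) :
    IntegrableOn (lagBound n N α) (orthant n) := by
  refine integrableOn_orthant_prod (f := fun _ t => gammaKernel α t * ((1 + t : ℝ) : ℂ) ^ (n * N))
    fun _ => ?_
  have h : ∀ k ∈ range (n * N + 1), IntegrableOn
      (fun t => ((n * N).choose k : ℂ) * gammaKernel (α + k) t) (Set.Ioi 0) := fun k _ =>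
    (integrableOn_gammaKernel (by simp; positivity)).const_mul _
  refine IntegrableOn.congr_fun (integrable_finsetSum _ h) (fun t ht => ?_) measurableSet_Ioi
  have h0 : (t : ℂ) ≠ 0 := ofReal_ne_zero.2 (ne_of_gt ht)
  rw [ofReal_add, ofReal_one, add_comm (1 : ℂ), add_pow, mul_sum]
  refine sum_congr rfl fun k _ => ?_
  rw [gammaKernel, gammaKernel, show (α : ℂ) + k - 1 = (α - 1) + k by ring, cpow_add _ _ h0,
    cpow_natCast, one_pow]
  ring

lemma vdm_le {n : ℕ} {x : Fin n → ℝ} (hx : x ∈ chamber n) :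
    vdm x ≤ ∏ i, (1 + x i) ^ n := by
  have h1 : ∀ i, 1 ≤ 1 + x i := fun i => by linarith [hx.1 i]
  have h2 : ∀ i, ∏ j ∈ Ioi i, (x j - x i) ≤ ∏ j, (1 + x j) := fun i =>
    (prod_le_prod (fun j hj => sub_nonneg.2 (hx.2 (mem_Ioi.1 hj)).le)
      fun j _ => by linarith [hx.1 i]).trans
      (prod_le_prod_of_subset_of_one_le (subset_univ _)
        (fun j _ => zero_le_one.trans (h1 j)) fun j _ _ => h1 j)
  refine (prod_le_prod (fun i _ => prod_nonneg fun j hj =>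
    sub_nonneg.2 (hx.2 (mem_Ioi.1 hj)).le) fun i _ => h2 i).trans_eq ?_
  rw [prod_const, card_univ, Fintype.card_fin, prod_pow]

lemma norm_lag_le {n N : ℕ} {x : Fin n → ℝ} (hx : x ∈ chamber n) (α : ℂ) {γ : ℂ}
    (hγ : 0 ≤ γ.re) (hN : 2 * γ.re ≤ N) : ‖lag α γ x‖ ≤ ‖lagBound n N α.re x‖ := by
  have h1 : ∀ i, 1 ≤ 1 + x i := fun i => by linarith [hx.1 i]
  have hP : 1 ≤ ∏ i, (1 + x i) ^ n := Finset.prod_induction _ (fun r : ℝ => 1 ≤ r)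
    (fun a b ha hb => one_le_mul_of_one_le_of_one_le ha hb) le_rfl fun i _ => one_le_pow₀ (h1 i)
  have hv : ‖(vdm x : ℂ) ^ (2 * γ)‖ ≤ ∏ i, (1 + x i) ^ (n * N) := by
    rw [norm_cpow_eq_rpow_re_of_pos (vdm_pos hx.2)]
    have hre : (2 * γ).re = 2 * γ.re := by simp
    rw [hre]
    calc vdm x ^ (2 * γ.re) ≤ (∏ i, (1 + x i) ^ n) ^ (2 * γ.re) :=
          Real.rpow_le_rpow (vdm_pos hx.2).le (vdm_le hx) (by positivity)
      _ ≤ (∏ i, (1 + x i) ^ n) ^ (N : ℝ) := Real.rpow_le_rpow_of_exponent_le hP hN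
      _ = _ := by rw [Real.rpow_natCast, ← prod_pow]; simp_rw [pow_mul]
  have hk : ∀ i, ‖gammaKernel α.re (x i)‖ = ‖Complex.exp (-(x i))‖ * ‖(x i : ℂ) ^ (α - 1)‖ :=
    fun i => by
      rw [gammaKernel, norm_mul, norm_cpow_eq_rpow_re_of_pos (hx.1 i),
        norm_cpow_eq_rpow_re_of_pos (hx.1 i)]
      simp
  have hpow : ∀ i, ‖((1 + x i : ℝ) : ℂ) ^ (n * N)‖ = (1 + x i) ^ (n * N) := fun i => by
    rw [norm_pow, norm_real, Real.norm_of_nonneg (zero_le_one.trans (h1 i))]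
  rw [lag, lagBound, ← sum_neg_distrib, Complex.exp_sum, norm_mul, norm_mul, norm_prod, norm_prod,
    norm_prod]
  simp only [norm_mul, hk, hpow, prod_mul_distrib]
  gcongr

lemma integrableOn_lag {n : ℕ} {α γ : ℂ} (hα : 0 < α.re) (hγ : 0 ≤ γ.re) :
    IntegrableOn (lag (n := n) α γ) (chamber n) := by
  obtain ⟨N, hN⟩ := exists_nat_ge (2 * γ.re)
  have h := (integrableOn_lagBound n N hα).mono_set (fun x hx => hx.1 : chamber n ⊆ orthant n)
  exact Integrable.mono h (measurable_lag α γ).aestronglyMeasurable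
    ((ae_restrict_iff' (measurableSet_chamber n)).2
      (Filter.Eventually.of_forall fun x hx => norm_lag_le hx α hγ hN))

/-- The pairs of interlacing points of the chambers of ranks `m` and `m + 1`. -/
def interlacePairs (m : ℕ) : Set ((Fin m → ℝ) × (Fin (m + 1) → ℝ)) :=
  {p | p.1 ∈ chamber m ∧ p.2 ∈ interlace (Fin.cons 0 p.1 : Fin (m + 1) → ℝ)}

/-- The integrand of Anderson's double integral. -/
noncomputable def andersonKernel {m : ℕ} (α γ : ℂ) (p : (Fin m → ℝ) × (Fin (m + 1) → ℝ)) : ℂ :=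
  vdm p.1 * (vdm p.2 *
    cross (Fin.cons 0 p.1 : Fin (m + 1) → ℝ) p.2 (Fin.cons α fun _ => γ) *
    Complex.exp (-∑ i, (p.2 i : ℂ)))

lemma cross_cons_zero {m n : ℕ} (a : Fin m → ℝ) (x : Fin n → ℝ) (α γ : ℂ) :
    cross (Fin.cons 0 a : Fin (m + 1) → ℝ) x (Fin.cons α fun _ => γ) =
      (∏ i, ((|x i| : ℝ) : ℂ) ^ (α - 1)) * cross a x fun _ => γ := by
  simp [cross, Fin.prod_univ_succ]

lemma measurable_andersonKernel {m : ℕ} (α γ : ℂ) : Measurable (andersonKernel (m := m) α γ) := by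
  unfold andersonKernel
  simp only [cross_cons_zero]
  unfold cross
  have h1 : Measurable fun p : (Fin m → ℝ) × (Fin (m + 1) → ℝ) => vdm p.1 :=
    measurable_vdm.comp measurable_fst
  have h2 : Measurable fun p : (Fin m → ℝ) × (Fin (m + 1) → ℝ) => vdm p.2 :=
    measurable_vdm.comp measurable_snd
  fun_prop

lemma measurableSet_interlacePairs (m : ℕ) : MeasurableSet (interlacePairs m) := by
  have h : interlacePairs m = {p | p.1 ∈ chamber m} ∩ {p | p.2 ∈ chamber (m + 1)} ∩
      ({p | ∀ i : Fin m, p.2 i.castSucc < p.1 i ∧ ∀ j, i < j → p.1 i < p.2 j.castSucc} ∩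
        {p | ∀ i, p.1 i < p.2 (Fin.last m)}) := by
    ext p
    have h := interlace_cons_zero_iff p.1 p.2
    simp only [interlacePairs, interlace, Fin.init, Set.mem_ofPred_eq, Set.mem_inter_iff] at h ⊢
    tauto
  rw [h]
  refine ((measurable_fst (measurableSet_chamber m)).inter
    (measurable_snd (measurableSet_chamber (m + 1)))).inter (MeasurableSet.inter ?_ ?_)
  · simp only [Set.ofPred_forall, Set.ofPred_and]
    refine MeasurableSet.iInter fun i => (measurableSet_lt (by fun_prop) (by fun_prop)).inter ?_
    exact MeasurableSet.iInter fun j => MeasurableSet.iInter fun _ =>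
      measurableSet_lt (by fun_prop) (by fun_prop)
  · simp only [Set.ofPred_forall]
    exact MeasurableSet.iInter fun i => measurableSet_lt (by fun_prop) (by fun_prop)

lemma strictMono_cons_zero {m : ℕ} {a : Fin m → ℝ} (ha : a ∈ chamber m) :
    StrictMono (Fin.cons 0 a : Fin (m + 1) → ℝ) := by
  intro i j hij
  induction j using Fin.cases with
  | zero => exact absurd hij (Fin.not_lt_zero i)
  | succ l =>
    induction i using Fin.cases with
    | zero => simpa using ha.1 l
    | succ k => simpa using ha.2 (Fin.succ_lt_succ_iff.1 hij)

lemma re_cons_pos {m : ℕ} {α γ : ℂ} (hα : 0 < α.re) (hγ : 0 < γ.re) (j : Fin (m + 1)) :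
    0 < ((Fin.cons α fun _ => γ : Fin (m + 1) → ℂ) j).re := by
  induction j using Fin.cases with
  | zero => simpa
  | succ k => simpa

lemma indicator_interlacePairs_of_mem {m : ℕ} {a : Fin m → ℝ} (ha : a ∈ chamber m)
    (f : (Fin m → ℝ) × (Fin (m + 1) → ℝ) → ℂ) :
    (fun x => (interlacePairs m).indicator f (a, x)) =
      (interlace (Fin.cons 0 a : Fin (m + 1) → ℝ)).indicator fun x => f (a, x) := by
  funext x
  have h : (a, x) ∈ interlacePairs m ↔ x ∈ interlace (Fin.cons 0 a : Fin (m + 1) → ℝ) :=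
    and_iff_right ha
  by_cases hx : x ∈ interlace (Fin.cons 0 a : Fin (m + 1) → ℝ)
  · rw [Set.indicator_of_mem (h.2 hx), Set.indicator_of_mem hx]
  · rw [Set.indicator_of_notMem (mt h.1 hx), Set.indicator_of_notMem hx]

lemma indicator_interlacePairs_of_notMem {m : ℕ} {a : Fin m → ℝ} (ha : a ∉ chamber m)
    (f : (Fin m → ℝ) × (Fin (m + 1) → ℝ) → ℂ) :
    (fun x => (interlacePairs m).indicator f (a, x)) = fun _ => 0 := by
  funext x
  simp [Set.indicator, interlacePairs, ha]

lemma integral_andersonKernel_snd {m : ℕ} {α γ : ℂ} (hα : 0 < α.re) (hγ : 0 < γ.re)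
    (a : Fin m → ℝ) :
    ∫ x, (interlacePairs m).indicator (andersonKernel α γ) (a, x) =
      (chamber m).indicator
        (fun a => Complex.Gamma α * Complex.Gamma γ ^ m * lag (α + γ) γ a) a := by
  by_cases ha : a ∈ chamber m
  · rw [indicator_interlacePairs_of_mem ha, integral_indicator (isOpen_interlace _).measurableSet,
      Set.indicator_of_mem ha]
    simp only [andersonKernel]
    rw [integral_const_mul, integral_interlace_exp (strictMono_cons_zero ha) (re_cons_pos hα hγ),
      ← lag_of_cons_zero ha, Fin.prod_univ_succ]
    simp only [Fin.cons_zero, Fin.cons_succ, prod_const, card_univ, Fintype.card_fin]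
    ring
  · rw [indicator_interlacePairs_of_notMem ha, Set.indicator_of_notMem ha, integral_zero]

lemma norm_andersonKernel {m : ℕ} (α γ : ℂ) (p : (Fin m → ℝ) × (Fin (m + 1) → ℝ)) :
    (‖(interlacePairs m).indicator (andersonKernel α γ) p‖ : ℂ) =
      (interlacePairs m).indicator (andersonKernel (α.re : ℂ) (γ.re : ℂ)) p := by
  by_cases hp : p ∈ interlacePairs m
  · rw [Set.indicator_of_mem hp, Set.indicator_of_mem hp]
    have hpos := hp
    rw [interlacePairs, Set.mem_ofPred_eq, interlace_cons_zero_iff] at hpos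
    have h : ∀ {r : ℝ}, 0 < r → ∀ s : ℂ, (‖(r : ℂ) ^ s‖ : ℂ) = (r : ℂ) ^ (s.re : ℂ) :=
      fun hr s => by rw [norm_cpow_eq_rpow_re_of_pos hr, ofReal_cpow hr.le]
    have hne : ∀ j i, 0 < |p.1 j - p.2 i| := fun j i => by
      rw [abs_pos, sub_ne_zero]
      rcases Fin.eq_castSucc_or_eq_last i with ⟨l, rfl⟩ | rfl
      · rcases le_or_gt l j with hlj | hlj
        · exact ((hpos.1.2.monotone (Fin.castSucc_le_castSucc_iff.2 hlj)).trans_lt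
            (hpos.2.1 j).1).ne'
        · exact ((hpos.2.1 j).2 l hlj).ne
      · exact (hpos.2.2 j).ne
    have hx : ∀ i, 0 < |p.2 i| := fun i => abs_pos.2 (hpos.1.1 i).ne'
    simp only [andersonKernel, cross_cons_zero]
    simp only [cross, norm_mul, norm_prod, ofReal_mul, ofReal_prod, h (hne _ _), h (hx _), Complex.norm_exp, norm_real,
      Real.norm_of_nonneg (vdm_pos hp.1.2).le, Real.norm_of_nonneg (vdm_pos hpos.1.2).le]
    simp
  · rw [Set.indicator_of_notMem hp, Set.indicator_of_notMem hp, norm_zero, ofReal_zero]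

lemma integrable_andersonKernel {m : ℕ} {α γ : ℂ} (hα : 0 < α.re) (hγ : 0 < γ.re) :
    Integrable ((interlacePairs m).indicator (andersonKernel α γ)) := by
  rw [Measure.volume_eq_prod, integrable_prod_iff
    ((measurable_andersonKernel α γ).indicator
      (measurableSet_interlacePairs m)).aestronglyMeasurable]
  refine ⟨Filter.Eventually.of_forall fun a => ?_, ?_⟩
  · by_cases ha : a ∈ chamber m
    · rw [indicator_interlacePairs_of_mem ha]
      refine (integrable_indicator_iff (isOpen_interlace _).measurableSet).2 ?_
      simp only [andersonKernel]
      exact ((integrableOn_interlace_exp (strictMono_cons_zero ha) (re_cons_pos hα hγ)).const_mul _)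
    · rw [indicator_interlacePairs_of_notMem ha]
      exact integrable_zero _ _ _
  · have hα' : 0 < (α.re : ℂ).re := by simpa
    have hγ' : 0 < (γ.re : ℂ).re := by simpa
    have h := (integrable_indicator_iff (measurableSet_chamber m)).2
      ((integrableOn_lag (n := m) (α := α.re + γ.re) (γ := γ.re) (by simp; positivity)
        hγ'.le).const_mul (Complex.Gamma α.re * Complex.Gamma γ.re ^ m))
    refine h.re.congr (Filter.Eventually.of_forall fun a => ?_)
    have h' := integral_andersonKernel_snd hα' hγ' a
    simp_rw [← norm_andersonKernel] at h'
    rw [integral_complex_ofReal] at h'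
    simp only [← h']
    simp

lemma integral_andersonKernel_fst {m : ℕ} (α γ : ℂ) (x : Fin (m + 1) → ℝ) :
    ∫ a, (interlacePairs m).indicator (andersonKernel α γ) (a, x) =
      (chamber (m + 1)).indicator (fun x =>
        (∫ v in simplexRegion m 1, dirichletKernel (fun _ => γ) γ 1 v) * lag α γ x) x := by
  by_cases hx : x ∈ chamber (m + 1)
  · have hinit : StrictMono (Fin.init x) :=
      fun i j hij => hx.2 (Fin.castSucc_lt_castSucc_iff.2 hij)
    have hlast : ∀ j : Fin m, Fin.init x j < x (Fin.last m) :=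
      fun j => hx.2 (Fin.castSucc_lt_last j)
    have hmeas : MeasurableSet (interlace (Fin.init x) ∩ {a | ∀ i, a i < x (Fin.last m)}) := by
      refine (isOpen_interlace _).measurableSet.inter ?_
      rw [Set.ofPred_forall]
      exact MeasurableSet.iInter fun i => measurableSet_lt (by fun_prop) measurable_const
    have hF : (fun a => (interlacePairs m).indicator (andersonKernel α γ) (a, x)) =
        (interlace (Fin.init x) ∩ {a | ∀ i, a i < x (Fin.last m)}).indicator
          fun a => andersonKernel α γ (a, x) := by
      funext a
      have h : (a, x) ∈ interlacePairs m ↔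
          a ∈ interlace (Fin.init x) ∩ {a | ∀ i, a i < x (Fin.last m)} :=
        (interlace_cons_zero_iff a x).trans (and_iff_right hx)
      by_cases ha : a ∈ interlace (Fin.init x) ∩ {a | ∀ i, a i < x (Fin.last m)}
      · rw [Set.indicator_of_mem (h.2 ha), Set.indicator_of_mem ha]
      · rw [Set.indicator_of_notMem (mt h.1 ha), Set.indicator_of_notMem ha]
    rw [hF, integral_indicator hmeas, Set.indicator_of_mem hx, ← lag_of_init hx,
      mul_left_comm, ← integral_interlace_lt hinit _ _ hlast, ← integral_const_mul]
    refine setIntegral_congr_fun hmeas fun a ha => ?_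
    have hcross : cross a x (fun _ => γ) = cross (Fin.init x) a (fun _ => γ) *
        ∏ i, ((x (Fin.last m) - a i : ℝ) : ℂ) ^ (γ - 1) := by
      rw [cross, prod_comm, Fin.prod_univ_castSucc, cross]
      congr 1
      · refine prod_congr rfl fun i _ => prod_congr rfl fun j _ => ?_
        rw [abs_sub_comm, Fin.init]
      · refine prod_congr rfl fun j _ => ?_
        rw [abs_sub_comm, abs_of_pos (sub_pos.2 (ha.2 j))]
    simp only [andersonKernel, cross_cons_zero, hcross, abs_of_pos (hx.1 _)]
    ring
  · have hF : (fun a => (interlacePairs m).indicator (andersonKernel α γ) (a, x)) = fun _ => 0 := by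
      funext a
      simp [Set.indicator, interlacePairs, interlace_cons_zero_iff, hx]
    rw [hF, Set.indicator_of_notMem hx, integral_zero]

theorem integral_lag_succ (m : ℕ) {α γ : ℂ} (hα : 0 < α.re) (hγ : 0 < γ.re) :
    Complex.Gamma γ * ∫ x in chamber (m + 1), lag α γ x =
      Complex.Gamma α * Complex.Gamma ((m + 1) * γ) * ∫ x in chamber m, lag (α + γ) γ x := by
  have h := integral_integral_swap (μ := volume) (ν := volume)
    (f := fun a x => (interlacePairs m).indicator (andersonKernel α γ) (a, x))
    (integrable_andersonKernel hα hγ)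
  simp only [integral_andersonKernel_snd hα hγ, integral_andersonKernel_fst] at h
  rw [integral_indicator (measurableSet_chamber _), integral_indicator (measurableSet_chamber _),
    integral_const_mul, integral_const_mul] at h
  have hD := dirichlet_integral (n := m) (s := fun _ => γ) (fun _ => hγ) hγ
  have hsum : ∑ _i : Fin m, γ + γ = (m + 1) * γ := by simp; ring
  rw [hsum, prod_const, card_univ, Fintype.card_fin] at hD
  have hG : Complex.Gamma γ ^ m ≠ 0 := pow_ne_zero _ (Gamma_ne_zero_of_re_pos hγ)
  refine mul_left_cancel₀ hG ?_
  rw [← mul_assoc, ← hD]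
  linear_combination (-Complex.Gamma ((m + 1) * γ)) * h

lemma integral_lag_zero (α γ : ℂ) : ∫ x in chamber 0, lag α γ x = 1 := by
  have h : chamber 0 = Set.univ :=
    Set.eq_univ_of_forall fun x => ⟨fun i => i.elim0, fun i => i.elim0⟩
  rw [h, Measure.restrict_univ, integral_unique]
  simp [lag, vdm, Measure.real, volume_pi]

lemma factorial_mul_integral_lag_of_pos (n : ℕ) {α γ : ℂ} (hα : 0 < α.re) (hγ : 0 < γ.re) :
    n.factorial * ∫ x in chamber n, lag α γ x =
      ∏ j ∈ range n, Complex.Gamma (α + j * γ) *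
        (Complex.Gamma (1 + (j + 1) * γ) / Complex.Gamma (1 + γ)) := by
  induction n generalizing α with
  | zero => simp [integral_lag_zero]
  | succ m ih =>
    have hne : γ ≠ 0 := fun h => by simp [h] at hγ
    have hG := Gamma_ne_zero_of_re_pos hγ
    have hm : ((m : ℂ) + 1) ≠ 0 := Nat.cast_add_one_ne_zero m
    have h := integral_lag_succ m hα hγ
    have ih' := ih (α := α + γ) (by simp; positivity)
    have hq : Complex.Gamma (1 + (m + 1) * γ) / Complex.Gamma (1 + γ) =
        (m + 1) * (Complex.Gamma ((m + 1) * γ) / Complex.Gamma γ) := by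
      rw [add_comm 1, add_comm 1, Gamma_add_one _ (mul_ne_zero hm hne), Gamma_add_one _ hne]
      field_simp
    have hshift : ∏ j ∈ range (m + 1), Complex.Gamma (α + j * γ) =
        (∏ j ∈ range m, Complex.Gamma (α + γ + j * γ)) * Complex.Gamma α := by
      rw [prod_range_succ']
      simp only [Nat.cast_add, Nat.cast_one, Nat.cast_zero, zero_mul, add_zero]
      congr 1
      exact prod_congr rfl fun j _ => by ring_nf
    rw [prod_mul_distrib] at ih' ⊢
    rw [hshift, prod_range_succ, hq, Nat.factorial_succ]
    push_cast
    rw [mul_comm, ← eq_div_iff hG] at h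
    rw [h]
    linear_combination (m + 1) * Complex.Gamma α * Complex.Gamma ((m + 1) * γ) /
      Complex.Gamma γ * ih'

lemma tendsto_integral_lag {n : ℕ} {α γ : ℂ} (hα : 0 < α.re) (hγ : 0 ≤ γ.re) :
    Filter.Tendsto (fun ε : ℝ => ∫ x in chamber n, lag α (γ + ε) x)
      (nhdsWithin 0 (Set.Ioi 0)) (nhds (∫ x in chamber n, lag α γ x)) := by
  obtain ⟨N, hN⟩ := exists_nat_ge (2 * (γ.re + 1))
  have hev : ∀ᶠ ε : ℝ in nhdsWithin 0 (Set.Ioi 0), 0 < ε ∧ ε < 1 :=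
    Ioo_mem_nhdsGT one_pos
  refine tendsto_integral_filter_of_dominated_convergence (fun x => ‖lagBound n N α.re x‖)
    (Filter.Eventually.of_forall fun ε => (measurable_lag α _).aestronglyMeasurable) ?_
    ((integrableOn_lagBound n N hα).mono_set (fun x hx => hx.1 : chamber n ⊆ orthant n)).norm ?_
  · filter_upwards [hev] with ε hε
    refine (ae_restrict_iff' (measurableSet_chamber n)).2 (Filter.Eventually.of_forall fun x hx =>
      norm_lag_le hx α ?_ ?_)
    · simp only [add_re, ofReal_re]
      linarith
    · simp only [add_re, ofReal_re]
      linarith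
  · refine (ae_restrict_iff' (measurableSet_chamber n)).2 (Filter.Eventually.of_forall fun x hx => ?_)
    have h0 : (vdm x : ℂ) ≠ 0 := ofReal_ne_zero.2 (vdm_pos hx.2).ne'
    have hc : Continuous fun ε : ℝ => lag α (γ + ε) x := by
      unfold lag
      exact continuous_const.mul (Continuous.const_cpow (by fun_prop) (Or.inl h0))
    have := hc.tendsto 0
    simp only [ofReal_zero, add_zero] at this
    exact this.mono_left nhdsWithin_le_nhds

lemma continuousAt_Gamma_of_re_pos {s : ℂ} (hs : 0 < s.re) : ContinuousAt Complex.Gamma s :=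
  (differentiableAt_Gamma s fun m h => by
    rw [h] at hs
    simp at hs
    linarith [(Nat.cast_nonneg m : (0 : ℝ) ≤ m)]).continuousAt

/-- The Laguerre case of the Selberg integral. -/
theorem factorial_mul_integral_lag (n : ℕ) {α γ : ℂ} (hα : 0 < α.re) (hγ : 0 ≤ γ.re) :
    n.factorial * ∫ x in chamber n, lag α γ x =
      ∏ j ∈ range n, Complex.Gamma (α + j * γ) *
        (Complex.Gamma (1 + (j + 1) * γ) / Complex.Gamma (1 + γ)) := by
  have hl := (tendsto_integral_lag (n := n) hα hγ).const_mul (n.factorial : ℂ)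
  have hG : ∀ (c a : ℂ), 0 < (a + c * γ).re → Filter.Tendsto
      (fun ε : ℝ => Complex.Gamma (a + c * (γ + ε))) (nhds 0)
      (nhds (Complex.Gamma (a + c * γ))) := fun c a h => by
    refine (continuousAt_Gamma_of_re_pos h).tendsto.comp ?_
    have : Continuous fun ε : ℝ => a + c * (γ + ε) := by fun_prop
    simpa using this.tendsto 0
  have h1 : ∀ j : ℕ, 0 ≤ ((j : ℂ) * γ).re := fun j => by
    simp only [mul_re, natCast_re, natCast_im, zero_mul, sub_zero]
    positivity
  have hr := tendsto_finsetProd (range n) fun j _ =>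
    (hG j α (by rw [add_re]; linarith [h1 j])).mul
      ((hG (j + 1) 1 (by rw [add_re, one_re]; have := h1 (j + 1); push_cast at this; linarith)).div
        (hG 1 1 (by simp; positivity)) (by
          refine Gamma_ne_zero_of_re_pos ?_
          simp
          positivity))
  simp only [one_mul] at hr
  refine tendsto_nhds_unique hl ((hr.mono_left nhdsWithin_le_nhds).congr' ?_)
  filter_upwards [self_mem_nhdsWithin] with ε hε
  rw [factorial_mul_integral_lag_of_pos n hα (by simp; linarith [Set.mem_Ioi.1 hε])]
  rfl

lemma integral_eq_card_mul_setIntegral {G X : Type*} [Fintype G] [MeasurableSpace X]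
    {μ : Measure X} {T : G → X → X} (hT : ∀ g, MeasurePreserving (T g) μ μ) {S : Set X}
    (hS : MeasurableSet S) (hunique : ∀ᵐ x ∂μ, ∃! g, T g x ∈ S) {f : X → ℂ}
    (hf : ∀ g x, f (T g x) = f x) (hint : IntegrableOn f S μ) :
    ∫ x, f x ∂μ = Fintype.card G * ∫ x in S, f x ∂μ := by
  have hind : Integrable (S.indicator f) μ := (integrable_indicator_iff hS).2 hint
  have hsum : ∀ᵐ x ∂μ, f x = ∑ g, S.indicator f (T g x) := by
    filter_upwards [hunique] with x ⟨g, hg, huniq⟩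
    rw [sum_eq_single g (fun b _ hb => Set.indicator_of_notMem (fun h => hb (huniq b h)) _)
      (fun h => absurd (mem_univ g) h), Set.indicator_of_mem hg, hf]
  have hcomp : ∀ g, ∫ x, S.indicator f (T g x) ∂μ = ∫ x in S, f x ∂μ := fun g => by
    rw [← integral_indicator hS]
    conv_rhs => rw [← (hT g).map_eq]
    refine (integral_map (hT g).aemeasurable ?_).symm
    rw [(hT g).map_eq]
    exact hind.aestronglyMeasurable
  have hcompint : ∀ g ∈ univ, Integrable (fun x => S.indicator f (T g x)) μ := fun g _ =>
    (hT g).integrable_comp_of_integrable hind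
  rw [integral_congr_ae hsum, integral_finsetSum _ hcompint]
  simp [hcomp]

/-- The action of the hyperoctahedral group by signed permutations of the coordinates. -/
def signedPerm {n : ℕ} (g : (Fin n → ℤˣ) × Equiv.Perm (Fin n)) (x : Fin n → ℝ) (i : Fin n) : ℝ :=
  ((g.1 i : ℤ) : ℝ) * x (g.2 i)

lemma abs_signedPerm {n : ℕ} (g : (Fin n → ℤˣ) × Equiv.Perm (Fin n)) (x : Fin n → ℝ) (i : Fin n) :
    |signedPerm g x i| = |x (g.2 i)| := by
  rcases Int.units_eq_one_or (g.1 i) with h | h <;> simp [signedPerm, h]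

lemma measurePreserving_signedPerm {n : ℕ} (g : (Fin n → ℤˣ) × Equiv.Perm (Fin n)) :
    MeasurePreserving (signedPerm g) := by
  have h1 : MeasurePreserving (fun (x : Fin n → ℝ) i => ((g.1 i : ℤ) : ℝ) * x i) := by
    refine volume_preserving_pi (f := fun i t => ((g.1 i : ℤ) : ℝ) * t) fun i => ?_
    rcases Int.units_eq_one_or (g.1 i) with h | h
    · simp only [h, Units.val_one, Int.cast_one, one_mul]
      exact MeasurePreserving.id volume
    · simpa [h] using Measure.measurePreserving_neg volume
  exact h1.comp (volume_preserving_arrowCongr' g.2.symm (MeasurableEquiv.refl ℝ)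
    (MeasurePreserving.id volume))

lemma ae_linear_ne_zero {n : ℕ} {φ : (Fin n → ℝ) →ₗ[ℝ] ℝ} (hφ : φ ≠ 0) :
    ∀ᵐ x, φ x ≠ 0 := by
  rw [ae_iff]
  simp only [not_not]
  exact Measure.addHaar_submodule volume (LinearMap.ker φ) (mt LinearMap.ker_eq_top.1 hφ)

lemma ae_ne_zero_and_abs_injective (n : ℕ) :
    ∀ᵐ x : Fin n → ℝ, (∀ i, x i ≠ 0) ∧ Function.Injective fun i => |x i| := by
  have h1 : ∀ i : Fin n, ∀ᵐ x : Fin n → ℝ, x i ≠ 0 := fun i =>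
    ae_linear_ne_zero (φ := LinearMap.proj i) fun h => by
      simpa using LinearMap.congr_fun h (Pi.single i 1)
  have h2 : ∀ i j : Fin n, i ≠ j → ∀ᵐ x : Fin n → ℝ, x i - x j ≠ 0 := fun i j hij =>
    ae_linear_ne_zero (φ := (LinearMap.proj i : (Fin n → ℝ) →ₗ[ℝ] ℝ) - LinearMap.proj j) fun h => by
      simpa [hij, hij.symm] using LinearMap.congr_fun h (Pi.single i 1)
  have h3 : ∀ i j : Fin n, i ≠ j → ∀ᵐ x : Fin n → ℝ, x i + x j ≠ 0 := fun i j hij =>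
    ae_linear_ne_zero (φ := (LinearMap.proj i : (Fin n → ℝ) →ₗ[ℝ] ℝ) + LinearMap.proj j) fun h => by
      simpa [hij, hij.symm] using LinearMap.congr_fun h (Pi.single i 1)
  simp only [← Filter.eventually_all] at h1 h2 h3
  filter_upwards [h1, h2, h3] with x hx1 hx2 hx3
  refine ⟨hx1, fun i j hij => ?_⟩
  by_contra hne
  rcases abs_eq_abs.1 hij with h | h
  · exact hx2 i j hne (sub_eq_zero.2 h)
  · exact hx3 i j hne (by rw [h, neg_add_cancel])

lemma existsUnique_signedPerm_mem_chamber {n : ℕ} {x : Fin n → ℝ} (h0 : ∀ i, x i ≠ 0)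
    (hinj : Function.Injective fun i => |x i|) : ∃! g, signedPerm g x ∈ chamber n := by
  have habs : ∀ g, (∀ i, 0 < signedPerm g x i) → signedPerm g x = (fun i => |x i|) ∘ g.2 :=
    fun g hg => funext fun i => by rw [Function.comp_apply, ← abs_signedPerm, abs_of_pos (hg i)]
  set σ : Equiv.Perm (Fin n) := Tuple.sort fun i => |x i|
  set ε : Fin n → ℤˣ := fun i => if 0 < x (σ i) then 1 else -1 with hε
  have hpos : ∀ i, 0 < signedPerm (ε, σ) x i := fun i => by
    by_cases h : 0 < x (σ i)
    · simp [signedPerm, hε, h]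
    · simpa [signedPerm, hε, h] using lt_of_le_of_ne (not_lt.1 h) (h0 _)
  have hmono : StrictMono (signedPerm (ε, σ) x) := by
    rw [habs _ hpos]
    exact (Tuple.monotone_sort _).strictMono_of_injective (hinj.comp σ.injective)
  refine ⟨(ε, σ), ⟨hpos, hmono⟩, fun g hg => ?_⟩
  have heq : signedPerm g x = signedPerm (ε, σ) x := by
    refine strictMono_eq_of_range_eq hg.2 hmono ?_
    rw [habs _ hg.1, habs _ hpos, g.2.surjective.range_comp, σ.surjective.range_comp]
  have hperm : g.2 = σ := Equiv.ext fun i => hinj (by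
    have := congrFun heq i
    rwa [habs _ hg.1, habs _ hpos] at this)
  refine Prod.ext (funext fun i => ?_) hperm
  have h := congrFun heq i
  rw [signedPerm, signedPerm, hperm] at h
  exact Units.ext (Int.cast_injective (mul_right_cancel₀ (h0 _) h))

lemma integral_eq_integral_chamber {n : ℕ} {f : (Fin n → ℝ) → ℂ}
    (hf : ∀ g x, f (signedPerm g x) = f x) (hint : IntegrableOn f (chamber n)) :
    ∫ x, f x = 2 ^ n * n.factorial * ∫ x in chamber n, f x := by
  rw [integral_eq_card_mul_setIntegral measurePreserving_signedPerm (measurableSet_chamber n)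
    ((ae_ne_zero_and_abs_injective n).mono fun x hx =>
      existsUnique_signedPerm_mem_chamber hx.1 hx.2) hf hint]
  simp [Fintype.card_perm]

/-- The coordinatewise map `t ↦ t ^ 2 / 2`. -/
noncomputable def halfSq {n : ℕ} (x : Fin n → ℝ) (i : Fin n) : ℝ := x i ^ 2 / 2

/-- The derivative of `halfSq`. -/
noncomputable def halfSqDeriv {n : ℕ} (x : Fin n → ℝ) : (Fin n → ℝ) →L[ℝ] (Fin n → ℝ) :=
  LinearMap.toContinuousLinearMap (Matrix.toLin' (Matrix.diagonal x))

lemma hasFDerivAt_halfSq {n : ℕ} (x : Fin n → ℝ) : HasFDerivAt halfSq (halfSqDeriv x) x := by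
  rw [hasFDerivAt_pi']
  intro i
  have h : HasFDerivAt (fun y : Fin n → ℝ => y i ^ 2 / 2)
      ((x i) • ContinuousLinearMap.proj (R := ℝ) (φ := fun _ : Fin n => ℝ) i) x := by
    have := ((hasFDerivAt_apply (𝕜 := ℝ) i x).pow 2).mul_const (2⁻¹ : ℝ)
    convert! this using 1
    ext v
    simp
    ring
  convert! h using 1
  ext v
  simp [halfSqDeriv, Matrix.mulVec_diagonal]

lemma det_halfSqDeriv {n : ℕ} {x : Fin n → ℝ} (hx : x ∈ orthant n) :
    |(halfSqDeriv x).det| = ∏ i, x i := by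
  rw [halfSqDeriv, ContinuousLinearMap.det, LinearMap.coe_toContinuousLinearMap,
    LinearMap.det_toLin', Matrix.det_diagonal, abs_of_pos (prod_pos fun j _ => hx j)]

lemma halfSq_lt_halfSq {n : ℕ} {x : Fin n → ℝ} (hx : x ∈ orthant n) {i j : Fin n} :
    halfSq x i < halfSq x j ↔ x i < x j := by
  rw [halfSq, halfSq, div_lt_div_iff_of_pos_right two_pos, sq_lt_sq₀ (hx i).le (hx j).le]

lemma halfSq_mem_chamber_iff {n : ℕ} {x : Fin n → ℝ} (hx : x ∈ orthant n) :
    halfSq x ∈ chamber n ↔ x ∈ chamber n := by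
  have h : halfSq x ∈ orthant n := fun i => by have := hx i; rw [halfSq]; positivity
  simp only [chamber, Set.mem_ofPred_eq, h, hx, StrictMono, halfSq_lt_halfSq hx]

lemma image_halfSq_chamber (n : ℕ) : halfSq '' chamber n = chamber n := by
  ext t
  constructor
  · rintro ⟨x, hx, rfl⟩
    exact (halfSq_mem_chamber_iff hx.1).2 hx
  · intro ht
    have h : halfSq (fun i => √(2 * t i)) = t := funext fun i => by
      rw [halfSq, Real.sq_sqrt (by linarith [ht.1 i])]
      ring
    refine ⟨fun i => √(2 * t i), (halfSq_mem_chamber_iff fun i => ?_).1 (by rwa [h]), h⟩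
    exact Real.sqrt_pos.2 (by linarith [ht.1 i])

lemma injOn_halfSq (n : ℕ) : Set.InjOn (halfSq (n := n)) (chamber n) := fun x hx y hy h => by
  funext i
  have := congrFun h i
  rw [halfSq, halfSq, div_left_inj' two_ne_zero] at this
  exact (sq_eq_sq₀ (hx.1 i).le (hy.1 i).le).1 this

lemma integral_chamber_halfSq {n : ℕ} (g : (Fin n → ℝ) → ℂ) :
    ∫ t in chamber n, g t = ∫ x in chamber n, (∏ i, (x i : ℂ)) * g (halfSq x) := by
  conv_lhs => rw [← image_halfSq_chamber]
  rw [integral_image_eq_integral_abs_det_fderiv_smul volume (measurableSet_chamber n)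
    (fun x _ => (hasFDerivAt_halfSq x).hasFDerivWithinAt) (injOn_halfSq n)]
  refine setIntegral_congr_fun (measurableSet_chamber n) fun x hx => ?_
  simp only [det_halfSqDeriv hx.1, real_smul, ofReal_prod]

lemma integrableOn_chamber_halfSq {n : ℕ} {g : (Fin n → ℝ) → ℂ} (hg : IntegrableOn g (chamber n)) :
    IntegrableOn (fun x => (∏ i, (x i : ℂ)) * g (halfSq x)) (chamber n) := by
  rw [← image_halfSq_chamber, integrableOn_image_iff_integrableOn_abs_det_fderiv_smul volume
    (measurableSet_chamber n) (fun x _ => (hasFDerivAt_halfSq x).hasFDerivWithinAt)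
    (injOn_halfSq n)] at hg
  refine hg.congr_fun (fun x hx => ?_) (measurableSet_chamber n)
  simp only [det_halfSqDeriv hx.1, real_smul, ofReal_prod]

/-- The integrand of the Macdonald-Mehta integral of type `B_n`. -/
noncomputable def mehta {n : ℕ} (k₁ k₂ : ℂ) (x : Fin n → ℝ) : ℂ :=
  (∏ j, ((|x j| : ℝ) : ℂ) ^ (2 * k₁)) *
    (∏ p ∈ Finset.univ.filter (fun p : Fin n × Fin n => p.1 < p.2),
      ((|x p.1 ^ 2 - x p.2 ^ 2| : ℝ) : ℂ) ^ (2 * k₂)) *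
    Complex.exp (-(∑ i, ((x i : ℂ)) ^ 2) / 2)

lemma prod_filter_lt {n : ℕ} {M : Type*} [CommMonoid M] (f : Fin n → Fin n → M) :
    ∏ p ∈ univ.filter (fun p : Fin n × Fin n => p.1 < p.2), f p.1 p.2 =
      ∏ i, ∏ j ∈ Ioi i, f i j := by
  rw [prod_filter, Fintype.prod_prod_type]
  refine prod_congr rfl fun i _ => ?_
  rw [← prod_filter, Finset.filter_lt_eq_Ioi]

lemma prod_filter_lt_perm {n : ℕ} {M : Type*} [CommMonoid M] (σ : Equiv.Perm (Fin n))
    {f : Fin n → Fin n → M} (hf : ∀ i j, f i j = f j i) :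
    ∏ p ∈ univ.filter (fun p : Fin n × Fin n => p.1 < p.2), f (σ p.1) (σ p.2) =
      ∏ p ∈ univ.filter (fun p : Fin n × Fin n => p.1 < p.2), f p.1 p.2 := by
  refine prod_nbij' (fun p => if σ p.1 < σ p.2 then (σ p.1, σ p.2) else (σ p.2, σ p.1))
    (fun p => if σ.symm p.1 < σ.symm p.2 then (σ.symm p.1, σ.symm p.2)
      else (σ.symm p.2, σ.symm p.1)) ?_ ?_ ?_ ?_ ?_
  · intro p hp
    simp only [mem_filter, mem_univ, true_and] at hp ⊢
    split_ifs with h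
    · exact h
    · exact lt_of_le_of_ne (not_lt.1 h) (σ.injective.ne hp.ne')
  · intro p hp
    simp only [mem_filter, mem_univ, true_and] at hp ⊢
    split_ifs with h
    · exact h
    · exact lt_of_le_of_ne (not_lt.1 h) (σ.symm.injective.ne hp.ne')
  · intro p hp
    simp only [mem_filter, mem_univ, true_and] at hp
    by_cases h : σ p.1 < σ p.2 <;> simp [h, hp, hp.not_gt]
  · intro p hp
    simp only [mem_filter, mem_univ, true_and] at hp
    by_cases h : σ.symm p.1 < σ.symm p.2 <;> simp [h, hp, hp.not_gt]
  · intro p _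
    split_ifs
    · rfl
    · exact hf _ _

lemma mehta_signedPerm {n : ℕ} (k₁ k₂ : ℂ) (g : (Fin n → ℤˣ) × Equiv.Perm (Fin n))
    (x : Fin n → ℝ) : mehta k₁ k₂ (signedPerm g x) = mehta k₁ k₂ x := by
  have hsq : ∀ i, signedPerm g x i ^ 2 = x (g.2 i) ^ 2 := fun i => by
    rw [← sq_abs, abs_signedPerm, sq_abs]
  have hsqC : ∀ i, (signedPerm g x i : ℂ) ^ 2 = (x (g.2 i) : ℂ) ^ 2 := fun i => by
    exact_mod_cast congrArg ((↑) : ℝ → ℂ) (hsq i)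
  simp only [mehta, abs_signedPerm, hsq, hsqC]
  rw [Equiv.prod_comp g.2 fun i => ((|x i| : ℝ) : ℂ) ^ (2 * k₁),
    Equiv.sum_comp g.2 fun i => (x i : ℂ) ^ 2,
    prod_filter_lt_perm g.2 (f := fun i j => ((|x i ^ 2 - x j ^ 2| : ℝ) : ℂ) ^ (2 * k₂))
      fun i j => by rw [abs_sub_comm]]

lemma prod_pow_card_Ioi {n : ℕ} (w : ℂ) :
    ∏ i : Fin n, w ^ (Ioi i).card = ∏ j ∈ range n, w ^ j := by
  simp only [Fin.card_Ioi]
  rw [Fin.prod_univ_eq_prod_range (fun i => w ^ (n - 1 - i)) n,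
    prod_range_reflect (fun i => w ^ i) n]

lemma mehta_eq {n : ℕ} (k₁ k₂ : ℂ) {x : Fin n → ℝ} (hx : x ∈ chamber n) :
    mehta k₁ k₂ x = (∏ j ∈ range n, (2 : ℂ) ^ (k₁ - 1 / 2) * ((2 : ℂ) ^ (2 * k₂)) ^ j) *
      ((∏ i, (x i : ℂ)) * lag (k₁ + 1 / 2) k₂ (halfSq x)) := by
  have hc := (halfSq_mem_chamber_iff hx.1).2 hx
  have h1 : ∀ i, ((|x i| : ℝ) : ℂ) ^ (2 * k₁) =
      (2 : ℂ) ^ (k₁ - 1 / 2) * ((x i : ℂ) * (halfSq x i : ℂ) ^ (k₁ + 1 / 2 - 1)) := fun i => by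
    have hi := hx.1 i
    have h0 : (x i : ℂ) ≠ 0 := ofReal_ne_zero.2 hi.ne'
    have hsq : (x i : ℂ) ^ (2 * k₁ - 1) = (2 : ℂ) ^ (k₁ - 1 / 2) *
        (halfSq x i : ℂ) ^ (k₁ - 1 / 2) := by
      rw [← ofReal_ofNat, ← mul_cpow_ofReal_nonneg zero_le_two (hc.1 i).le, ← ofReal_mul, halfSq,
        mul_div_cancel₀ _ (two_ne_zero' ℝ), sq, ofReal_mul,
        mul_cpow_ofReal_nonneg hi.le hi.le, ← cpow_add _ _ h0]
      push_cast
      ring_nf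
    rw [abs_of_pos hi, show k₁ + 1 / 2 - 1 = k₁ - 1 / 2 by ring, mul_left_comm, ← hsq,
      show 2 * k₁ = 1 + (2 * k₁ - 1) by ring, cpow_add _ _ h0, cpow_one]
    ring_nf
  have h2 : ∏ i, ∏ j ∈ Ioi i, ((|x i ^ 2 - x j ^ 2| : ℝ) : ℂ) ^ (2 * k₂) =
      (∏ j ∈ range n, ((2 : ℂ) ^ (2 * k₂)) ^ j) * (vdm (halfSq x) : ℂ) ^ (2 * k₂) := by
    have hnn : ∀ i, ∀ j ∈ Ioi i, 0 ≤ halfSq x j - halfSq x i := fun i j hj =>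
      sub_nonneg.2 (hc.2 (mem_Ioi.1 hj)).le
    rw [vdm, ofReal_prod_cpow _ fun i _ => prod_nonneg (hnn i), ← prod_pow_card_Ioi,
      ← prod_mul_distrib]
    refine prod_congr rfl fun i _ => ?_
    rw [ofReal_prod_cpow _ (hnn i), ← prod_const, ← prod_mul_distrib]
    refine prod_congr rfl fun j hj => ?_
    rw [← ofReal_ofNat, ← mul_cpow_ofReal_nonneg zero_le_two (hnn i j hj), ← ofReal_mul,
      abs_sub_comm, abs_of_nonneg]
    · rw [halfSq, halfSq]
      ring_nf
    · have := hnn i j hj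
      rw [halfSq, halfSq] at this
      linarith
  have h3 : -(∑ i, (x i : ℂ) ^ 2) / 2 = -∑ i, (halfSq x i : ℂ) := by
    rw [neg_div, sum_div]
    simp [halfSq]
  rw [mehta, prod_filter_lt fun i j => ((|x i ^ 2 - x j ^ 2| : ℝ) : ℂ) ^ (2 * k₂), h2, h3, lag,
    prod_mul_distrib, prod_const, card_range]
  simp only [h1, prod_mul_distrib, prod_const, card_univ, Fintype.card_fin]
  ring

lemma integral_mehta (n : ℕ) {k₁ k₂ : ℂ} (hk₁ : 0 ≤ k₁.re) (hk₂ : 0 ≤ k₂.re) :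
    ∫ x : Fin n → ℝ, mehta k₁ k₂ x =
      ∏ j ∈ range n, 2 * ((2 : ℂ) ^ (k₁ - 1 / 2) * ((2 : ℂ) ^ (2 * k₂)) ^ j) *
        (Complex.Gamma (k₁ + 1 / 2 + j * k₂) *
          (Complex.Gamma (1 + (j + 1) * k₂) / Complex.Gamma (1 + k₂))) := by
  have hα : 0 < (k₁ + 1 / 2).re := by
    rw [add_re]
    norm_num
    linarith
  have hcongr : Set.EqOn (mehta k₁ k₂) _ (chamber n) := fun x hx => mehta_eq k₁ k₂ hx
  have hint : IntegrableOn (mehta k₁ k₂) (chamber n) :=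
    IntegrableOn.congr_fun ((integrableOn_chamber_halfSq (integrableOn_lag hα hk₂)).const_mul _)
      hcongr.symm (measurableSet_chamber n)
  rw [integral_eq_integral_chamber (mehta_signedPerm k₁ k₂) hint,
    setIntegral_congr_fun (measurableSet_chamber n) hcongr, integral_const_mul,
    ← integral_chamber_halfSq]
  have h := factorial_mul_integral_lag n hα hk₂
  simp only [prod_mul_distrib, prod_const, card_range] at h ⊢
  linear_combination 2 ^ n * (((2 : ℂ) ^ (k₁ - 1 / 2)) ^ n *
    ∏ j ∈ range n, ((2 : ℂ) ^ (2 * k₂)) ^ j) * h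

lemma Gamma_one_add_two_mul_div {z : ℂ} (hz : 0 ≤ z.re) :
    Complex.Gamma (1 + 2 * z) / Complex.Gamma (1 + z) =
      (2 : ℂ) ^ (2 * z) * Complex.Gamma (z + 1 / 2) / (√Real.pi : ℝ) := by
  have h := Gamma_mul_Gamma_add_half (z + 1 / 2)
  have hG : Complex.Gamma (1 + z) ≠ 0 := Gamma_ne_zero_of_re_pos (by rw [add_re, one_re]; linarith)
  have hpi : ((√Real.pi : ℝ) : ℂ) ≠ 0 := ofReal_ne_zero.2 (Real.sqrt_ne_zero'.2 Real.pi_pos)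
  rw [show z + 1 / 2 + 1 / 2 = 1 + z by ring, show 2 * (z + 1 / 2) = 1 + 2 * z by ring,
    show 1 - (1 + 2 * z) = -(2 * z) by ring, cpow_neg] at h
  have h2 : (2 : ℂ) ^ (2 * z) ≠ 0 := by simp [cpow_eq_zero_iff]
  field_simp at h ⊢
  linear_combination -h

end MacdonaldMehta

/-- The two-parameter Macdonald-Mehta integral for the root system `B_n`
(Macdonald, via the Selberg integral): for `Re k₁, Re k₂ ≥ 0`,
`(2π)^{-n/2} ∫_{ℝ^n} ∏_j |x_j|^{2k₁} ∏_{j<k}|x_j²−x_k²|^{2k₂} e^{-|x|²/2} dx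
  = 2^{-n k₁} ∏_{j=1}^n [Γ(1+2k₁+2k₂(j−1))/Γ(1+k₁+k₂(j−1))]·[Γ(1+j k₂)/Γ(1+k₂)]`. -/
theorem macdonald_mehta_Bn (n : ℕ) (hn : 1 ≤ n) (k₁ k₂ : ℂ)
    (hk₁ : 0 ≤ k₁.re) (hk₂ : 0 ≤ k₂.re) :
    ((2 * Real.pi : ℝ) : ℂ) ^ (-(n : ℂ) / 2) *
      ∫ x : Fin n → ℝ,
        (∏ j, ((|x j| : ℝ) : ℂ) ^ (2 * k₁)) *
        (∏ p ∈ Finset.univ.filter (fun p : Fin n × Fin n => p.1 < p.2),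
          ((|x p.1 ^ 2 - x p.2 ^ 2| : ℝ) : ℂ) ^ (2 * k₂)) *
        Complex.exp (-(∑ i, ((x i : ℂ)) ^ 2) / 2)
      = (2 : ℂ) ^ (-(n : ℂ) * k₁) *
        ∏ j ∈ Finset.range n,
          (Complex.Gamma (1 + 2 * k₁ + 2 * k₂ * j) / Complex.Gamma (1 + k₁ + k₂ * j)) *
          (Complex.Gamma (1 + (j + 1) * k₂) / Complex.Gamma (1 + k₂)) := by
  have h := MacdonaldMehta.integral_mehta n hk₁ hk₂
  simp only [MacdonaldMehta.mehta] at h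
  have h2 : (2 : ℂ) ≠ 0 := two_ne_zero
  have hsqrt : ((√Real.pi : ℝ) : ℂ) = (Real.pi : ℂ) ^ (1 / 2 : ℂ) := by
    rw [Real.sqrt_eq_rpow, ofReal_cpow Real.pi_pos.le]
    norm_num
  have hconst : ((2 * Real.pi : ℝ) : ℂ) ^ (-(n : ℂ) / 2) =
      ∏ _j ∈ range n, (2 : ℂ) ^ (-(1 / 2) : ℂ) * (Real.pi : ℂ) ^ (-(1 / 2) : ℂ) := by
    rw [prod_const, card_range, ← ofReal_ofNat, ← mul_cpow_ofReal_nonneg zero_le_two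
      Real.pi_pos.le, ← ofReal_mul, ← cpow_nat_mul]
    ring_nf
  have hpow : (2 : ℂ) ^ (-(n : ℂ) * k₁) = ∏ _j ∈ range n, (2 : ℂ) ^ (-k₁) := by
    rw [prod_const, card_range, ← cpow_nat_mul]
    ring_nf
  rw [h, hconst, hpow, ← prod_mul_distrib, ← prod_mul_distrib]
  refine prod_congr rfl fun j _ => ?_
  have hz : 0 ≤ (k₁ + k₂ * j).re := by
    simp only [add_re, mul_re, natCast_re, natCast_im, mul_zero, sub_zero]
    positivity
  have hdup := MacdonaldMehta.Gamma_one_add_two_mul_div hz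
  rw [show 1 + 2 * k₁ + 2 * k₂ * j = 1 + 2 * (k₁ + k₂ * j) by ring,
    show 1 + k₁ + k₂ * j = 1 + (k₁ + k₂ * j) by ring, hdup, hsqrt,
    show k₁ + 1 / 2 + j * k₂ = k₁ + k₂ * j + 1 / 2 by ring, cpow_neg (Real.pi : ℂ)]
  have htwo : (2 : ℂ) ^ (-(1 / 2) : ℂ) * (2 * ((2 : ℂ) ^ (k₁ - 1 / 2) *
      ((2 : ℂ) ^ (2 * k₂)) ^ j)) = (2 : ℂ) ^ (-k₁) * (2 : ℂ) ^ (2 * (k₁ + k₂ * j)) := by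
    calc _ = (2 : ℂ) ^ (-(1 / 2) : ℂ) * ((2 : ℂ) ^ (1 : ℂ) *
          ((2 : ℂ) ^ (k₁ - 1 / 2) * (2 : ℂ) ^ (j * (2 * k₂)))) := by rw [cpow_one, cpow_nat_mul]
      _ = _ := by
        simp only [← cpow_add _ _ h2]
        ring_nf
  linear_combination (Complex.Gamma (k₁ + k₂ * j + 1 / 2) / (Real.pi : ℂ) ^ (1 / 2 : ℂ) *
    (Complex.Gamma (1 + (j + 1) * k₂) / Complex.Gamma (1 + k₂))) * htwo
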